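/- Under the noncompact stability setup with hypotheses (H1), (H2), (H3) and (H4⁻), suppose for each n ∈ ℕ the function u^n : X_n → ℝ is a metric viscosity supersolution of H_n(x, u^n, |∇_{d_n} u^n|) = 0 on (X_n, d_n), and the family (u^n) is uniformly bounded. Then the lower semilimit u̲(x) := inf{ liminf_{n→∞} u^n(x_n) : x_n ∈ X_n, 𝖽(x_n, x) → 0 }, defined for x ∈ X_∞, is a metric viscosity supersolution of H_∞(x, u̲, |∇_{d_∞} u̲|) = 0 on (X_∞, d_∞). -/

import Mathlib

open Filter Metric Set Topology

/-- Local slope of `u` at `x`, relative to a set `s` and a distance-like function `ρ`. -/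
noncomputable def slopeWrt {α : Type*} [TopologicalSpace α] (s : Set α) (ρ : α → α → ℝ)
    (u : α → ℝ) (x : α) : ℝ :=
  Filter.limsup (fun y => |u y - u x| / ρ x y) (nhdsWithin x (s \ {x}))

/-- Upper local slope. -/
noncomputable def upperSlopeWrt {α : Type*} [TopologicalSpace α] (s : Set α) (ρ : α → α → ℝ)
    (u : α → ℝ) (x : α) : ℝ :=
  Filter.limsup (fun y => max (u y - u x) 0 / ρ x y) (nhdsWithin x (s \ {x}))

/-- Lower local slope. -/
noncomputable def lowerSlopeWrt {α : Type*} [TopologicalSpace α] (s : Set α) (ρ : α → α → ℝ)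
    (u : α → ℝ) (x : α) : ℝ :=
  Filter.limsup (fun y => max (u x - u y) 0 / ρ x y) (nhdsWithin x (s \ {x}))

/-- `u` is locally Lipschitz on `s` with respect to `ρ`. -/
def LocLipWrt {α : Type*} [TopologicalSpace α] (s : Set α) (ρ : α → α → ℝ)
    (u : α → ℝ) : Prop :=
  ∀ x ∈ s, ∃ K : ℝ, ∃ t ∈ nhdsWithin x s, ∀ y ∈ t ∩ s, ∀ z ∈ t ∩ s, |u y - u z| ≤ K * ρ y z

/-- `u` is of class `C^{1,-}`: locally Lipschitz, with continuous local slope which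
coincides with the lower local slope. -/
def IsC1MinusWrt {α : Type*} [TopologicalSpace α] (s : Set α) (ρ : α → α → ℝ)
    (u : α → ℝ) : Prop :=
  LocLipWrt s ρ u ∧ ContinuousOn (slopeWrt s ρ u) s ∧
    ∀ x ∈ s, lowerSlopeWrt s ρ u x = slopeWrt s ρ u x

/-- `u` is of class `C^{1,+}`: locally Lipschitz, with continuous local slope which
coincides with the upper local slope. -/
def IsC1PlusWrt {α : Type*} [TopologicalSpace α] (s : Set α) (ρ : α → α → ℝ)
    (u : α → ℝ) : Prop :=
  LocLipWrt s ρ u ∧ ContinuousOn (slopeWrt s ρ u) s ∧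
    ∀ x ∈ s, upperSlopeWrt s ρ u x = slopeWrt s ρ u x

/-- Upper semicontinuous envelope of `u` relative to `s`. -/
noncomputable def uscWrt {α : Type*} [TopologicalSpace α] (s : Set α) (u : α → ℝ) (x : α) : ℝ :=
  Filter.limsup u (nhdsWithin x s)

/-- Lower semicontinuous envelope of `u` relative to `s`. -/
noncomputable def lscWrt {α : Type*} [TopologicalSpace α] (s : Set α) (u : α → ℝ) (x : α) : ℝ :=
  Filter.liminf u (nhdsWithin x s)

/-- `H_a(x,r,p) = inf { H x r q | q ≥ 0, |q - p| ≤ a }`. -/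
noncomputable def Hlow {α : Type*} (H : α → ℝ → ℝ → ℝ) (a : ℝ) (x : α) (r p : ℝ) : ℝ :=
  sInf (H x r '' {q | 0 ≤ q ∧ |q - p| ≤ a})

/-- `H^a(x,r,p) = sup { H x r q | q ≥ 0, |q - p| ≤ a }`. -/
noncomputable def Hupp {α : Type*} (H : α → ℝ → ℝ → ℝ) (a : ℝ) (x : α) (r p : ℝ) : ℝ :=
  sSup (H x r '' {q | 0 ≤ q ∧ |q - p| ≤ a})

/-- Metric viscosity subsolution of `H(x, u, |∇u|) = 0` on the space `(s, ρ)`. -/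
def IsMVSubsolutionWrt {α : Type*} [TopologicalSpace α] (s : Set α) (ρ : α → α → ℝ)
    (H : α → ℝ → ℝ → ℝ) (u : α → ℝ) : Prop :=
  ∀ ψ₁ ψ₂ : α → ℝ, IsC1MinusWrt s ρ ψ₁ → LocLipWrt s ρ ψ₂ →
    ∀ x ∈ s, IsLocalMaxOn (fun y => uscWrt s u y - (ψ₁ y + ψ₂ y)) s x →
      Hlow H (uscWrt s (slopeWrt s ρ ψ₂) x) x (uscWrt s u x) (slopeWrt s ρ ψ₁ x) ≤ 0

/-- Metric viscosity supersolution of `H(x, u, |∇u|) = 0` on the space `(s, ρ)`. -/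
def IsMVSupersolutionWrt {α : Type*} [TopologicalSpace α] (s : Set α) (ρ : α → α → ℝ)
    (H : α → ℝ → ℝ → ℝ) (u : α → ℝ) : Prop :=
  ∀ ψ₁ ψ₂ : α → ℝ, IsC1PlusWrt s ρ ψ₁ → LocLipWrt s ρ ψ₂ →
    ∀ x ∈ s, IsLocalMinOn (fun y => lscWrt s u y - (ψ₁ y + ψ₂ y)) s x →
      0 ≤ Hupp H (uscWrt s (slopeWrt s ρ ψ₂) x) x (lscWrt s u x) (slopeWrt s ρ ψ₁ x)

/-- `(s, ρ)` is a geodesic space: any two points are joined by an isometric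
embedding of the interval `[0, ρ x y]`. -/
def IsGeodesicWrt {α : Type*} (s : Set α) (ρ : α → α → ℝ) : Prop :=
  ∀ x ∈ s, ∀ y ∈ s, ∃ γ : ℝ → α, γ 0 = x ∧ γ (ρ x y) = y ∧
    (∀ t ∈ Icc (0:ℝ) (ρ x y), γ t ∈ s) ∧
    ∀ t₁ ∈ Icc (0:ℝ) (ρ x y), ∀ t₂ ∈ Icc (0:ℝ) (ρ x y), ρ (γ t₁) (γ t₂) = |t₁ - t₂|

/-- Strict local maximum of `f` on `s` at `x`. -/
def IsStrictLocalMaxOn' {α : Type*} [TopologicalSpace α] (f : α → ℝ) (s : Set α) (x : α) : Prop :=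
  ∀ᶠ y in nhdsWithin x (s \ {x}), f y < f x

/-- Strict local minimum of `f` on `s` at `x`. -/
def IsStrictLocalMinOn' {α : Type*} [TopologicalSpace α] (f : α → ℝ) (s : Set α) (x : α) : Prop :=
  ∀ᶠ y in nhdsWithin x (s \ {x}), f x < f y

/-- `u` is locally bounded on `s`. -/
def LocBddWrt {α : Type*} [TopologicalSpace α] (s : Set α) (u : α → ℝ) : Prop :=
  ∀ x ∈ s, ∃ C : ℝ, ∀ᶠ y in nhdsWithin x s, |u y| ≤ C

/-- `ρ` is a metric on the subset `S` of the ambient metric space `Y`, bounded below by the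
ambient distance and inducing the subspace topology on `S`. -/
structure IsMetricOn {Y : Type*} [MetricSpace Y] (S : Set Y) (ρ : Y → Y → ℝ) : Prop where
  refl : ∀ x ∈ S, ρ x x = 0
  symm : ∀ x ∈ S, ∀ y ∈ S, ρ x y = ρ y x
  triangle : ∀ x ∈ S, ∀ y ∈ S, ∀ z ∈ S, ρ x z ≤ ρ x y + ρ y z
  ge_dist : ∀ x ∈ S, ∀ y ∈ S, dist x y ≤ ρ x y
  nhds_basis : ∀ x ∈ S, (nhdsWithin x S).HasBasis (fun ε : ℝ => 0 < ε)
    (fun ε => {y | y ∈ S ∧ ρ x y < ε})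

/-- Spatial local slope of `ψ : (0,∞) × X → ℝ` at `z = (t, x)`. -/
noncomputable def slopeSpWrt {α : Type*} [TopologicalSpace α] (s : Set α) (ρ : α → α → ℝ)
    (ψ : ℝ × α → ℝ) (z : ℝ × α) : ℝ :=
  Filter.limsup (fun y => |ψ (z.1, y) - ψ z| / ρ z.2 y) (nhdsWithin z.2 (s \ {z.2}))

/-- Spatial upper local slope. -/
noncomputable def upperSlopeSpWrt {α : Type*} [TopologicalSpace α] (s : Set α) (ρ : α → α → ℝ)
    (ψ : ℝ × α → ℝ) (z : ℝ × α) : ℝ :=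
  Filter.limsup (fun y => max (ψ (z.1, y) - ψ z) 0 / ρ z.2 y) (nhdsWithin z.2 (s \ {z.2}))

/-- Spatial lower local slope. -/
noncomputable def lowerSlopeSpWrt {α : Type*} [TopologicalSpace α] (s : Set α) (ρ : α → α → ℝ)
    (ψ : ℝ × α → ℝ) (z : ℝ × α) : ℝ :=
  Filter.limsup (fun y => max (ψ z - ψ (z.1, y)) 0 / ρ z.2 y) (nhdsWithin z.2 (s \ {z.2}))

/-- Product (max) metric on `ℝ × α` built from `ρ`. -/
def prodMet {α : Type*} (ρ : α → α → ℝ) : ℝ × α → ℝ × α → ℝ :=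
  fun z w => max |z.1 - w.1| (ρ z.2 w.2)

/-- Metric viscosity subsolution of `∂ₜ u + H(t, x, u, |∇u|) = 0` on `(0,∞) × (s, ρ)`. -/
def IsMVSubsolutionTWrt {α : Type*} [TopologicalSpace α] (s : Set α) (ρ : α → α → ℝ)
    (H : ℝ → α → ℝ → ℝ → ℝ) (u : ℝ × α → ℝ) : Prop :=
  ∀ ψ₁ ψ₂ dψ₁ dψ₂ : ℝ × α → ℝ,
    LocLipWrt (Ioi (0:ℝ) ×ˢ s) (prodMet ρ) ψ₁ →
    LocLipWrt (Ioi (0:ℝ) ×ˢ s) (prodMet ρ) ψ₂ →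
    (∀ z ∈ Ioi (0:ℝ) ×ˢ s, HasDerivAt (fun τ => ψ₁ (τ, z.2)) (dψ₁ z) z.1) →
    ContinuousOn dψ₁ (Ioi (0:ℝ) ×ˢ s) →
    (∀ z ∈ Ioi (0:ℝ) ×ˢ s, HasDerivAt (fun τ => ψ₂ (τ, z.2)) (dψ₂ z) z.1) →
    ContinuousOn dψ₂ (Ioi (0:ℝ) ×ˢ s) →
    ContinuousOn (slopeSpWrt s ρ ψ₁) (Ioi (0:ℝ) ×ˢ s) →
    (∀ z ∈ Ioi (0:ℝ) ×ˢ s, lowerSlopeSpWrt s ρ ψ₁ z = slopeSpWrt s ρ ψ₁ z) →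
    ∀ z ∈ Ioi (0:ℝ) ×ˢ s,
      IsLocalMaxOn (fun w => uscWrt (Ioi (0:ℝ) ×ˢ s) u w - (ψ₁ w + ψ₂ w))
        (Ioi (0:ℝ) ×ˢ s) z →
      dψ₁ z + dψ₂ z +
        Hlow (fun w : ℝ × α => H w.1 w.2)
          (uscWrt (Ioi (0:ℝ) ×ˢ s) (slopeSpWrt s ρ ψ₂) z) z
          (uscWrt (Ioi (0:ℝ) ×ˢ s) u z) (slopeSpWrt s ρ ψ₁ z) ≤ 0

/-- Metric viscosity supersolution of `∂ₜ u + H(t, x, u, |∇u|) = 0` on `(0,∞) × (s, ρ)`. -/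
def IsMVSupersolutionTWrt {α : Type*} [TopologicalSpace α] (s : Set α) (ρ : α → α → ℝ)
    (H : ℝ → α → ℝ → ℝ → ℝ) (u : ℝ × α → ℝ) : Prop :=
  ∀ ψ₁ ψ₂ dψ₁ dψ₂ : ℝ × α → ℝ,
    LocLipWrt (Ioi (0:ℝ) ×ˢ s) (prodMet ρ) ψ₁ →
    LocLipWrt (Ioi (0:ℝ) ×ˢ s) (prodMet ρ) ψ₂ →
    (∀ z ∈ Ioi (0:ℝ) ×ˢ s, HasDerivAt (fun τ => ψ₁ (τ, z.2)) (dψ₁ z) z.1) →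
    ContinuousOn dψ₁ (Ioi (0:ℝ) ×ˢ s) →
    (∀ z ∈ Ioi (0:ℝ) ×ˢ s, HasDerivAt (fun τ => ψ₂ (τ, z.2)) (dψ₂ z) z.1) →
    ContinuousOn dψ₂ (Ioi (0:ℝ) ×ˢ s) →
    ContinuousOn (slopeSpWrt s ρ ψ₁) (Ioi (0:ℝ) ×ˢ s) →
    (∀ z ∈ Ioi (0:ℝ) ×ˢ s, upperSlopeSpWrt s ρ ψ₁ z = slopeSpWrt s ρ ψ₁ z) →
    ∀ z ∈ Ioi (0:ℝ) ×ˢ s,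
      IsLocalMinOn (fun w => lscWrt (Ioi (0:ℝ) ×ˢ s) u w - (ψ₁ w + ψ₂ w))
        (Ioi (0:ℝ) ×ˢ s) z →
      0 ≤ dψ₁ z + dψ₂ z +
        Hupp (fun w : ℝ × α => H w.1 w.2)
          (uscWrt (Ioi (0:ℝ) ×ˢ s) (slopeSpWrt s ρ ψ₂) z) z
          (lscWrt (Ioi (0:ℝ) ×ˢ s) u z) (slopeSpWrt s ρ ψ₁ z)

theorem limsup_nonneg_of_eventually_nonneg {α : Type*} {F : Filter α} {f : α → ℝ}
    (h0 : ∀ᶠ x in F, 0 ≤ f x) : 0 ≤ limsup f F := by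
  rw [limsup_eq]
  rcases F.eq_or_neBot with rfl | hF
  · simp
  · refine Real.sInf_nonneg fun a ha => ?_
    obtain ⟨x, hx, hx'⟩ := (h0.and (show ∀ᶠ x in F, f x ≤ a from ha)).exists
    exact hx.trans hx'

theorem limsup_le_of_eventually_le_of_nonneg {α : Type*} {F : Filter α} {f : α → ℝ} {K : ℝ}
    (hK : 0 ≤ K) (h0 : ∀ᶠ x in F, 0 ≤ f x) (h1 : ∀ᶠ x in F, f x ≤ K) : limsup f F ≤ K := by
  rw [limsup_eq]
  rcases F.eq_or_neBot with rfl | hF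
  · simpa using hK
  · refine csInf_le ⟨0, fun a ha => ?_⟩ h1
    obtain ⟨x, hx, hx'⟩ := (h0.and (show ∀ᶠ x in F, f x ≤ a from ha)).exists
    exact hx.trans hx'

section Metric

variable {Y : Type*} [MetricSpace Y] {S : Set Y} {ρ : Y → Y → ℝ}

theorem IsMetricOn.nonneg (h : IsMetricOn S ρ) {x y : Y} (hx : x ∈ S) (hy : y ∈ S) :
    0 ≤ ρ x y :=
  dist_nonneg.trans (h.ge_dist x hx y hy)

theorem IsMetricOn.pos (h : IsMetricOn S ρ) {x y : Y} (hx : x ∈ S) (hy : y ∈ S) (hne : x ≠ y) :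
    0 < ρ x y :=
  (dist_pos.2 hne).trans_le (h.ge_dist x hx y hy)

theorem IsMetricOn.abs_sub_le (h : IsMetricOn S ρ) {x y z : Y} (hx : x ∈ S) (hy : y ∈ S)
    (hz : z ∈ S) : |ρ x y - ρ x z| ≤ ρ y z := by
  have h1 := h.triangle x hx y hy z hz
  have h2 := h.triangle x hx z hz y hy
  rw [h.symm z hz y hy] at h2
  rw [abs_le]; constructor <;> linarith

theorem IsMetricOn.eventually_lt (h : IsMetricOn S ρ) {x : Y} (hx : x ∈ S) {ε : ℝ} (hε : 0 < ε) :
    ∀ᶠ y in 𝓝[S] x, y ∈ S ∧ ρ x y < ε :=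
  (h.nhds_basis x hx).mem_of_mem hε

theorem IsMetricOn.exists_of_eventually (h : IsMetricOn S ρ) {x : Y} (hx : x ∈ S) {P : Y → Prop}
    (hP : ∀ᶠ y in 𝓝[S] x, P y) : ∃ ε > 0, ∀ y ∈ S, ρ x y < ε → P y := by
  obtain ⟨ε, hε, h'⟩ := (h.nhds_basis x hx).eventually_iff.1 hP
  exact ⟨ε, hε, fun y hy hd => h' ⟨hy, hd⟩⟩

theorem IsMetricOn.tendsto_of_tendsto (h : IsMetricOn S ρ) {β : Type*} {F : Filter β} {f : β → Y}
    {x : Y} (hx : x ∈ S) (hf : ∀ᶠ b in F, f b ∈ S) (h0 : Tendsto (fun b => ρ x (f b)) F (𝓝 0)) :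
    Tendsto f F (𝓝[S] x) := by
  refine (h.nhds_basis x hx).tendsto_right_iff.2 fun ε hε => ?_
  filter_upwards [hf, h0.eventually_lt_const hε] with b hb hb' using ⟨hb, hb'⟩

theorem IsMetricOn.continuousOn (h : IsMetricOn S ρ) {y : Y} (hy : y ∈ S) :
    ContinuousOn (ρ y) S := by
  intro x hx
  rw [ContinuousWithinAt, Metric.tendsto_nhds]
  intro ε hε
  filter_upwards [h.eventually_lt hx hε] with z hz
  rw [Real.dist_eq, abs_sub_comm]
  exact (h.abs_sub_le hy hx hz.1).trans_lt hz.2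

theorem eventually_diff_of_eventually {x : Y} {P : Y → Prop} (h : ∀ᶠ y in 𝓝[S] x, P y) :
    ∀ᶠ y in 𝓝[S \ {x}] x, P y ∧ y ∈ S ∧ y ≠ x := by
  filter_upwards [nhdsWithin_mono x sdiff_subset h, self_mem_nhdsWithin] with y h1 h2
  exact ⟨h1, h2.1, h2.2⟩

theorem slopeWrt_nonneg (h : IsMetricOn S ρ) {x : Y} (hx : x ∈ S) (u : Y → ℝ) :
    0 ≤ slopeWrt S ρ u x := by
  refine limsup_nonneg_of_eventually_nonneg ?_
  filter_upwards [self_mem_nhdsWithin] with y hy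
  exact div_nonneg (abs_nonneg _) (h.nonneg hx hy.1)

theorem upperSlopeWrt_nonneg (h : IsMetricOn S ρ) {x : Y} (hx : x ∈ S) (u : Y → ℝ) :
    0 ≤ upperSlopeWrt S ρ u x := by
  refine limsup_nonneg_of_eventually_nonneg ?_
  filter_upwards [self_mem_nhdsWithin] with y hy
  exact div_nonneg (le_max_right _ _) (h.nonneg hx hy.1)

theorem slopeWrt_le (h : IsMetricOn S ρ) {x : Y} (hx : x ∈ S) {u : Y → ℝ} {K : ℝ} (hK : 0 ≤ K)
    (hu : ∀ᶠ y in 𝓝[S] x, |u y - u x| ≤ K * ρ x y) : slopeWrt S ρ u x ≤ K := by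
  refine limsup_le_of_eventually_le_of_nonneg hK ?_ ?_
  · filter_upwards [self_mem_nhdsWithin] with y hy
    exact div_nonneg (abs_nonneg _) (h.nonneg hx hy.1)
  · filter_upwards [eventually_diff_of_eventually hu] with y hy
    rw [div_le_iff₀ (h.pos hx hy.2.1 hy.2.2.symm)]
    exact hy.1

theorem upperSlopeWrt_le (h : IsMetricOn S ρ) {x : Y} (hx : x ∈ S) {u : Y → ℝ} {K : ℝ}
    (hK : 0 ≤ K) (hu : ∀ᶠ y in 𝓝[S] x, u y - u x ≤ K * ρ x y) : upperSlopeWrt S ρ u x ≤ K := by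
  refine limsup_le_of_eventually_le_of_nonneg hK ?_ ?_
  · filter_upwards [self_mem_nhdsWithin] with y hy
    exact div_nonneg (le_max_right _ _) (h.nonneg hx hy.1)
  · filter_upwards [eventually_diff_of_eventually hu] with y hy
    rw [div_le_iff₀ (h.pos hx hy.2.1 hy.2.2.symm)]
    exact max_le hy.1 (mul_nonneg hK (h.nonneg hx hy.2.1))

theorem LocLipWrt.exists_eventually (h : IsMetricOn S ρ) {u : Y → ℝ} (hu : LocLipWrt S ρ u) {x : Y}
    (hx : x ∈ S) : ∃ K : ℝ, 0 ≤ K ∧ ∃ ε > 0, ∀ y ∈ S, ∀ z ∈ S, ρ x y < ε → ρ x z < ε →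
      |u y - u z| ≤ K * ρ y z := by
  obtain ⟨K, t, ht, hK⟩ := hu x hx
  obtain ⟨ε, hε, h'⟩ := h.exists_of_eventually hx (P := fun y => y ∈ t) ht
  refine ⟨max K 0, le_max_right _ _, ε, hε, fun y hy z hz h1 h2 => ?_⟩
  exact (hK y ⟨h' y hy h1, hy⟩ z ⟨h' z hz h2, hz⟩).trans
    (mul_le_mul_of_nonneg_right (le_max_left _ _) (h.nonneg hy hz))

theorem LocLipWrt.eventually_slope_lt (h : IsMetricOn S ρ) {u : Y → ℝ} (hu : LocLipWrt S ρ u)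
    {x : Y} (hx : x ∈ S) {K : ℝ} (hK : slopeWrt S ρ u x < K) :
    ∀ᶠ y in 𝓝[S] x, |u y - u x| ≤ K * ρ x y := by
  obtain ⟨K', hK', ε, hε, hl⟩ := hu.exists_eventually h hx
  have hb : ∀ᶠ y in 𝓝[S \ {x}] x, |u y - u x| / ρ x y < K := by
    refine eventually_lt_of_limsup_lt hK ⟨K', ?_⟩
    rw [eventually_map]
    filter_upwards [eventually_diff_of_eventually (h.eventually_lt hx hε)] with y hy
    rw [div_le_iff₀ (h.pos hx hy.2.1 hy.2.2.symm)]
    have := hl y hy.2.1 x hx hy.1.2 (by rw [h.refl x hx]; exact hε)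
    rwa [h.symm y hy.2.1 x hx] at this
  rw [eventually_nhdsWithin_iff] at hb ⊢
  filter_upwards [hb] with y hy hyS
  by_cases hxy : y = x
  · subst hxy; simp [h.refl y hx]
  · have := hy ⟨hyS, hxy⟩
    rw [div_lt_iff₀ (h.pos hx hyS (Ne.symm hxy))] at this
    exact this.le

/-- On a geodesic space, a bound for the local slope on a ball is a Lipschitz bound near the
centre. -/
theorem LocLipWrt.lipschitz_of_slope_lt (h : IsMetricOn S ρ) (hg : IsGeodesicWrt S ρ) {u : Y → ℝ}
    (hu : LocLipWrt S ρ u) {x₀ : Y} (hx₀ : x₀ ∈ S) {K R : ℝ}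
    (hs : ∀ x ∈ S, ρ x₀ x < R → slopeWrt S ρ u x < K) {y z : Y} (hy : y ∈ S) (hz : z ∈ S)
    (hyR : ρ x₀ y < R / 3) (hzR : ρ x₀ z < R / 3) : u z - u y ≤ K * ρ y z := by
  obtain ⟨γ, h0, h1, hS, hd⟩ := hg y hy z hz
  set l := ρ y z with hl
  have hl0 : 0 ≤ l := h.nonneg hy hz
  have hR : ∀ t ∈ Icc 0 l, ρ x₀ (γ t) < R := by
    intro t ht
    have a1 := h.triangle x₀ hx₀ y hy (γ t) (hS t ht)
    have a2 := hd 0 ⟨le_rfl, hl0⟩ t ht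
    rw [h0, zero_sub, abs_neg, abs_of_nonneg ht.1] at a2
    have a3 := h.triangle y hy x₀ hx₀ z hz
    rw [h.symm y hy x₀ hx₀] at a3
    have := ht.2
    linarith
  have hcont : ∀ t ∈ Icc 0 l, Tendsto γ (𝓝[Icc 0 l] t) (𝓝[S] (γ t)) := by
    intro t ht
    refine h.tendsto_of_tendsto (hS t ht) ?_ ?_
    · filter_upwards [self_mem_nhdsWithin] with t' ht' using hS t' ht'
    · have : Tendsto (fun t' => |t - t'|) (𝓝[Icc 0 l] t) (𝓝 0) := by
        have : Tendsto (fun t' => |t - t'|) (𝓝 t) (𝓝 (|t - t|)) := by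
          apply Continuous.tendsto; fun_prop
        simpa using this.mono_left nhdsWithin_le_nhds
      refine this.congr' ?_
      filter_upwards [self_mem_nhdsWithin] with t' ht' using (hd t ht t' ht').symm
  have key : ∀ t ∈ Icc 0 l, ∀ᶠ t' in 𝓝[Icc 0 l] t, |u (γ t') - u (γ t)| ≤ K * |t - t'| := by
    intro t ht
    have := (hcont t ht).eventually (hu.eventually_slope_lt h (hS t ht) (hs _ (hS t ht) (hR t ht)))
    filter_upwards [this, self_mem_nhdsWithin] with t' h' ht'
    rwa [hd t ht t' ht'] at h'
  have hc : ContinuousOn (fun t => u (γ t)) (Icc 0 l) := by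
    intro t ht
    rw [ContinuousWithinAt, tendsto_iff_dist_tendsto_zero]
    have : Tendsto (fun t' => K * |t - t'|) (𝓝[Icc 0 l] t) (𝓝 0) := by
      have : Tendsto (fun t' => K * |t - t'|) (𝓝 t) (𝓝 (K * |t - t|)) := by
        apply Continuous.tendsto; fun_prop
      simpa using this.mono_left nhdsWithin_le_nhds
    exact squeeze_zero' (Eventually.of_forall fun _ => dist_nonneg) (key t ht) this
  have := image_le_of_liminf_slope_right_le_deriv_boundary (f := fun t => u (γ t)) (a := 0) (b := l)
    hc (B := fun t => u y + K * t) (B' := fun _ => K) (by simp [h0])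
    (by fun_prop) (fun x _ => by
      simpa using ((hasDerivWithinAt_id x (Ici x)).const_mul K).const_add (u y)) ?_
    (x := l) ⟨hl0, le_rfl⟩
  · simp only [h1] at this; linarith
  · intro t ht r hr
    refine Eventually.frequently ?_
    have h1 := key t ⟨ht.1, ht.2.le⟩
    have h2 : ∀ᶠ t' in 𝓝[>] t, t' ∈ Icc 0 l := by
      filter_upwards [Ioo_mem_nhdsGT ht.2] with t' ht' using ⟨ht.1.trans ht'.1.le, ht'.2.le⟩
    have h3 : 𝓝[>] t ≤ 𝓝[Icc 0 l] t := le_inf (nhdsWithin_le_nhds) (le_principal_iff.2 h2)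
    filter_upwards [h3 h1, self_mem_nhdsWithin] with t' h' ht'
    have ht'' : t < t' := ht'
    rw [slope_def_field, div_lt_iff₀ (by linarith)]
    rw [abs_sub_comm t t', abs_of_pos (by linarith : 0 < t' - t)] at h'
    have := le_abs_self (u (γ t') - u (γ t))
    nlinarith


theorem locLipWrt_of_lipschitz {u : Y → ℝ} {K : ℝ}
    (h : ∀ y ∈ S, ∀ z ∈ S, |u y - u z| ≤ K * ρ y z) : LocLipWrt S ρ u :=
  fun _ _ => ⟨K, univ, univ_mem, fun y hy z hz => h y hy.2 z hz.2⟩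

/-- Increment of the smoothed modulus `√(s² + τ²)`. -/
theorem sqrt_sq_add_sub {τ : ℝ} (hτ : 0 < τ) (s t : ℝ) :
    √(t ^ 2 + τ ^ 2) - √(s ^ 2 + τ ^ 2) =
      (t - s) * ((t + s) / (√(t ^ 2 + τ ^ 2) + √(s ^ 2 + τ ^ 2))) := by
  have h1 : 0 < √(t ^ 2 + τ ^ 2) := by positivity
  have h2 : 0 < √(s ^ 2 + τ ^ 2) := by positivity
  have e1 : √(t ^ 2 + τ ^ 2) ^ 2 = t ^ 2 + τ ^ 2 := Real.sq_sqrt (by positivity)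
  have e2 : √(s ^ 2 + τ ^ 2) ^ 2 = s ^ 2 + τ ^ 2 := Real.sq_sqrt (by positivity)
  field_simp
  linear_combination e1 - e2

theorem abs_sqrt_sq_add_sub_le {τ : ℝ} (hτ : 0 < τ) {s t : ℝ} (hs : 0 ≤ s) (ht : 0 ≤ t) :
    |√(t ^ 2 + τ ^ 2) - √(s ^ 2 + τ ^ 2)| ≤ |t - s| := by
  have h1 : 0 < √(t ^ 2 + τ ^ 2) := by positivity
  have h2 : 0 < √(s ^ 2 + τ ^ 2) := by positivity
  rw [sqrt_sq_add_sub hτ, abs_mul]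
  refine mul_le_of_le_one_right (abs_nonneg _) ?_
  rw [abs_of_nonneg (by positivity), div_le_one (by positivity)]
  have a1 : s ≤ √(s ^ 2 + τ ^ 2) := Real.le_sqrt_of_sq_le (by nlinarith)
  have a2 : t ≤ √(t ^ 2 + τ ^ 2) := Real.le_sqrt_of_sq_le (by nlinarith)
  linarith

theorem tendsto_sqrt_slope {τ : ℝ} (hτ : 0 < τ) (p s : ℝ) :
    Tendsto (fun t => p * ((t + s) / (√(t ^ 2 + τ ^ 2) + √(s ^ 2 + τ ^ 2)))) (𝓝 s)
      (𝓝 (p * (s / √(s ^ 2 + τ ^ 2)))) := by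
  have hpos : ∀ t : ℝ, √(t ^ 2 + τ ^ 2) + √(s ^ 2 + τ ^ 2) ≠ 0 := fun t => by positivity
  have h2 : √(s ^ 2 + τ ^ 2) ≠ 0 := by positivity
  have : Continuous (fun t => p * ((t + s) / (√(t ^ 2 + τ ^ 2) + √(s ^ 2 + τ ^ 2)))) := by
    refine continuous_const.mul (Continuous.div ?_ ?_ hpos) <;> fun_prop
  convert this.tendsto s using 2
  field_simp

section SmoothedCone

variable {y : Y} {p τ : ℝ}

theorem smoothedCone_lipschitz (h : IsMetricOn S ρ) (hy : y ∈ S) (hp : 0 ≤ p) (hτ : 0 < τ) :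
    ∀ x ∈ S, ∀ z ∈ S,
      |-(p * √(ρ y x ^ 2 + τ ^ 2)) - -(p * √(ρ y z ^ 2 + τ ^ 2))| ≤ p * ρ x z := by
  intro x hx z hz
  have e : -(p * √(ρ y x ^ 2 + τ ^ 2)) - -(p * √(ρ y z ^ 2 + τ ^ 2)) =
      p * (√(ρ y z ^ 2 + τ ^ 2) - √(ρ y x ^ 2 + τ ^ 2)) := by ring
  rw [e, abs_mul, abs_of_nonneg hp]
  refine mul_le_mul_of_nonneg_left ?_ hp
  refine (abs_sqrt_sq_add_sub_le hτ (h.nonneg hy hx) (h.nonneg hy hz)).trans ?_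
  rw [abs_sub_comm]
  exact h.abs_sub_le hy hx hz

theorem smoothedCone_slope_le (h : IsMetricOn S ρ) (hy : y ∈ S) (hp : 0 ≤ p) (hτ : 0 < τ)
    {x : Y} (hx : x ∈ S) :
    slopeWrt S ρ (fun z => -(p * √(ρ y z ^ 2 + τ ^ 2))) x ≤
      p * (ρ y x / √(ρ y x ^ 2 + τ ^ 2)) := by
  have hs := h.nonneg hy hx
  refine le_of_forall_pos_le_add fun ε hε => slopeWrt_le h hx (by positivity) ?_
  have hc : Tendsto (ρ y) (𝓝[S] x) (𝓝 (ρ y x)) := h.continuousOn hy x hx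
  have := ((tendsto_sqrt_slope hτ p (ρ y x)).comp hc).eventually_lt_const (lt_add_of_pos_right _ hε)
  filter_upwards [this, self_mem_nhdsWithin] with z hz hzS
  have hz0 := h.nonneg hy hzS
  have e : -(p * √(ρ y z ^ 2 + τ ^ 2)) - -(p * √(ρ y x ^ 2 + τ ^ 2)) =
      -(p * (√(ρ y z ^ 2 + τ ^ 2) - √(ρ y x ^ 2 + τ ^ 2))) := by ring
  have hab := h.abs_sub_le hy hx hzS
  rw [abs_sub_comm] at hab
  rw [e, abs_neg, sqrt_sq_add_sub hτ, mul_left_comm, abs_mul,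
    abs_of_nonneg (by positivity :
      0 ≤ p * ((ρ y z + ρ y x) / (√(ρ y z ^ 2 + τ ^ 2) + √(ρ y x ^ 2 + τ ^ 2)))), mul_comm]
  exact mul_le_mul hz.le hab (abs_nonneg _) (by positivity)

theorem le_smoothedCone_upperSlope (h : IsMetricOn S ρ) (hg : IsGeodesicWrt S ρ) (hy : y ∈ S)
    (hp : 0 ≤ p) (hτ : 0 < τ) {x : Y} (hx : x ∈ S) :
    p * (ρ y x / √(ρ y x ^ 2 + τ ^ 2)) ≤
      upperSlopeWrt S ρ (fun z => -(p * √(ρ y z ^ 2 + τ ^ 2))) x := by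
  rcases (h.nonneg hy hx).eq_or_lt with hs | hs
  · rw [← hs]; simpa using upperSlopeWrt_nonneg h hx _
  by_contra! hlt
  obtain ⟨K, hK1, hK2⟩ := exists_between hlt
  have hb : ∀ᶠ z in 𝓝[S \ {x}] x, max (-(p * √(ρ y z ^ 2 + τ ^ 2)) -
      -(p * √(ρ y x ^ 2 + τ ^ 2))) 0 / ρ x z < K := by
    refine eventually_lt_of_limsup_lt hK1 ⟨p, ?_⟩
    rw [eventually_map]
    filter_upwards [self_mem_nhdsWithin] with z hz
    rw [div_le_iff₀ (h.pos hx hz.1 (Ne.symm hz.2))]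
    refine max_le ?_ (mul_nonneg hp (h.nonneg hx hz.1))
    have := (abs_le.1 (smoothedCone_lipschitz h hy hp hτ z hz.1 x hx)).2
    rwa [h.symm z hz.1 x hx] at this
  obtain ⟨γ, h0, h1, hS, hd⟩ := hg x hx y hy
  set l := ρ x y with hl
  have hls : ρ y x = l := h.symm y hy x hx
  rw [hls] at hs hK2 hb
  have hxt : ∀ t ∈ Icc 0 l, ρ x (γ t) = t := by
    intro t ht
    have := hd 0 ⟨le_rfl, hs.le⟩ t ht
    rwa [h0, zero_sub, abs_neg, abs_of_nonneg ht.1] at this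
  have hyt : ∀ t ∈ Icc 0 l, ρ y (γ t) = l - t := by
    intro t ht
    have := hd l ⟨hs.le, le_rfl⟩ t ht
    rwa [h1, abs_of_nonneg (by linarith [ht.2])] at this
  have hmem : ∀ᶠ t in 𝓝[>] (0 : ℝ), t ∈ Ioc 0 l := Ioc_mem_nhdsGT hs
  have ht0 : Tendsto γ (𝓝[>] 0) (𝓝[S \ {x}] x) := by
    have a1 : Tendsto γ (𝓝[>] 0) (𝓝[S] x) := by
      refine h.tendsto_of_tendsto hx ?_ ?_
      · filter_upwards [hmem] with t ht using hS t ⟨ht.1.le, ht.2⟩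
      · refine Tendsto.congr' ?_ (tendsto_id.mono_left nhdsWithin_le_nhds)
        filter_upwards [hmem] with t ht using (hxt t ⟨ht.1.le, ht.2⟩).symm
    refine tendsto_nhdsWithin_iff.2 ⟨a1.mono_right nhdsWithin_le_nhds, ?_⟩
    filter_upwards [hmem] with t ht
    refine ⟨hS t ⟨ht.1.le, ht.2⟩, fun hEq => ?_⟩
    have := hxt t ⟨ht.1.le, ht.2⟩
    rw [mem_singleton_iff.1 hEq, h.refl x hx] at this
    exact ht.1.ne this
  have hlim : Tendsto (fun t : ℝ => l - t) (𝓝[>] 0) (𝓝 l) := by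
    have : Tendsto (fun t : ℝ => l - t) (𝓝 0) (𝓝 (l - 0)) := by
      apply Continuous.tendsto; fun_prop
    simpa using this.mono_left nhdsWithin_le_nhds
  obtain ⟨t, ht, hb', hk⟩ := (hmem.and ((ht0.eventually hb).and
    (((tendsto_sqrt_slope hτ p l).comp hlim).eventually_const_lt hK2))).exists
  have htI : t ∈ Icc 0 l := ⟨ht.1.le, ht.2⟩
  rw [hxt t htI, hyt t htI, div_lt_iff₀ ht.1] at hb'
  have hb'' := (le_max_left _ _).trans_lt hb'
  have e : -(p * √((l - t) ^ 2 + τ ^ 2)) - -(p * √(l ^ 2 + τ ^ 2)) =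
      -(p * (√((l - t) ^ 2 + τ ^ 2) - √(l ^ 2 + τ ^ 2))) := by ring
  rw [e, sqrt_sq_add_sub hτ] at hb''
  simp only [Function.comp] at hk
  have := ht.1
  nlinarith

theorem smoothedCone_slope (h : IsMetricOn S ρ) (hg : IsGeodesicWrt S ρ) (hy : y ∈ S)
    (hp : 0 ≤ p) (hτ : 0 < τ) {x : Y} (hx : x ∈ S) :
    slopeWrt S ρ (fun z => -(p * √(ρ y z ^ 2 + τ ^ 2))) x =
        p * (ρ y x / √(ρ y x ^ 2 + τ ^ 2)) ∧
      upperSlopeWrt S ρ (fun z => -(p * √(ρ y z ^ 2 + τ ^ 2))) x =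
        p * (ρ y x / √(ρ y x ^ 2 + τ ^ 2)) := by
  have h1 := smoothedCone_slope_le h hy hp hτ hx
  have h2 := le_smoothedCone_upperSlope h hg hy hp hτ hx
  have h3 : upperSlopeWrt S ρ (fun z => -(p * √(ρ y z ^ 2 + τ ^ 2))) x ≤
      slopeWrt S ρ (fun z => -(p * √(ρ y z ^ 2 + τ ^ 2))) x := by
    refine le_of_forall_gt_imp_ge_of_dense fun K hK => upperSlopeWrt_le h hx
      ((slopeWrt_nonneg h hx _).trans hK.le) ?_
    filter_upwards [(locLipWrt_of_lipschitz (smoothedCone_lipschitz h hy hp hτ)).eventually_slope_lt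
      h hx hK] with z hz
    exact (le_abs_self _).trans hz
  exact ⟨le_antisymm h1 (h2.trans h3), le_antisymm (h3.trans h1) h2⟩

theorem smoothedCone_isC1Plus (h : IsMetricOn S ρ) (hg : IsGeodesicWrt S ρ) (hy : y ∈ S)
    (hp : 0 ≤ p) (hτ : 0 < τ) :
    IsC1PlusWrt S ρ (fun z => -(p * √(ρ y z ^ 2 + τ ^ 2))) := by
  refine ⟨locLipWrt_of_lipschitz (smoothedCone_lipschitz h hy hp hτ), ?_, fun x hx => ?_⟩
  · refine ContinuousOn.congr ?_ fun x hx => (smoothedCone_slope h hg hy hp hτ hx).1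
    have hc := h.continuousOn hy
    refine continuousOn_const.mul (hc.div ?_ fun x _ => by positivity)
    exact ((hc.pow 2).add continuousOn_const).sqrt
  · rw [(smoothedCone_slope h hg hy hp hτ hx).1, (smoothedCone_slope h hg hy hp hτ hx).2]

end SmoothedCone

section Envelope

variable {u : Y → ℝ} {C : ℝ}

theorem eventually_abs_le (hu : ∀ x ∈ S, |u x| ≤ C) (x : Y) : ∀ᶠ y in 𝓝[S] x, |u y| ≤ C := by
  filter_upwards [self_mem_nhdsWithin] with y hy using hu y hy

theorem neBot_nhdsWithin_of_mem {x : Y} (hx : x ∈ S) : (𝓝[S] x).NeBot :=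
  mem_closure_iff_nhdsWithin_neBot.1 (subset_closure hx)

theorem eventually_lt_of_lt_lscWrt (hu : ∀ x ∈ S, |u x| ≤ C) {x : Y} {b : ℝ}
    (hb : b < lscWrt S u x) : ∀ᶠ y in 𝓝[S] x, b < u y :=
  eventually_lt_of_lt_liminf hb
    ⟨-C, eventually_map.2 ((eventually_abs_le hu x).mono fun _ h => (abs_le.1 h).1)⟩

theorem frequently_lt_of_lscWrt_lt (hu : ∀ x ∈ S, |u x| ≤ C) {x : Y} (hx : x ∈ S) {b : ℝ}
    (hb : lscWrt S u x < b) : ∃ᶠ y in 𝓝[S] x, u y < b := by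
  have := neBot_nhdsWithin_of_mem hx
  have hbd : (𝓝[S] x).IsBoundedUnder (· ≤ ·) u :=
    ⟨C, eventually_map.2 ((eventually_abs_le hu x).mono fun _ h => (abs_le.1 h).2)⟩
  exact frequently_lt_of_liminf_lt hbd.isCoboundedUnder_ge hb

theorem le_lscWrt (hu : ∀ x ∈ S, |u x| ≤ C) {x : Y} (hx : x ∈ S) {c : ℝ}
    (hc : ∀ᶠ y in 𝓝[S] x, c ≤ u y) : c ≤ lscWrt S u x := by
  have := neBot_nhdsWithin_of_mem hx
  have hbd : (𝓝[S] x).IsBoundedUnder (· ≤ ·) u :=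
    ⟨C, eventually_map.2 ((eventually_abs_le hu x).mono fun _ h => (abs_le.1 h).2)⟩
  exact le_liminf_of_le hbd.isCoboundedUnder_ge hc

theorem lscWrt_le (hu : ∀ x ∈ S, |u x| ≤ C) {x : Y} (hx : x ∈ S) : lscWrt S u x ≤ u x :=
  le_of_forall_lt fun _ hb => (eventually_lt_of_lt_lscWrt hu hb).self_of_nhdsWithin hx

theorem abs_lscWrt_le (hu : ∀ x ∈ S, |u x| ≤ C) {x : Y} (hx : x ∈ S) : |lscWrt S u x| ≤ C :=
  abs_le.2 ⟨le_lscWrt hu hx ((eventually_abs_le hu x).mono fun _ h => (abs_le.1 h).1),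
    (lscWrt_le hu hx).trans (abs_le.1 (hu x hx)).2⟩

theorem lowerSemicontinuousOn_lscWrt (hu : ∀ x ∈ S, |u x| ≤ C) :
    LowerSemicontinuousOn (lscWrt S u) S := by
  intro x hx c hc
  obtain ⟨b, hcb, hb⟩ := exists_between hc
  have := eventually_eventually_nhdsWithin.2 (eventually_lt_of_lt_lscWrt hu hb)
  filter_upwards [this, self_mem_nhdsWithin] with y hy hyS
  exact hcb.trans_le (le_lscWrt hu hyS (hy.mono fun _ h => h.le))

end Envelope

theorem IsMetricOn.isClosed_closedBall (h : IsMetricOn S ρ) (hS : IsClosed S) {x : Y} (hx : x ∈ S)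
    (R : ℝ) : IsClosed {z | z ∈ S ∧ ρ x z ≤ R} :=
  (h.continuousOn hx).preimage_isClosed_of_isClosed hS isClosed_Iic

/-- Ekeland's variational principle. -/
theorem IsMetricOn.ekeland [CompleteSpace Y] (h : IsMetricOn S ρ) {D : Set Y} (hDS : D ⊆ S)
    (hD : IsClosed D) {G : Y → ℝ} (hG : LowerSemicontinuousOn G D) {m : ℝ}
    (hm : ∀ z ∈ D, m ≤ G z) {κ : ℝ} (hκ : 0 < κ) {z₀ : Y} (hz₀ : z₀ ∈ D) :
    ∃ z ∈ D, G z ≤ G z₀ ∧ ∀ w ∈ D, G z ≤ G w + κ * ρ z w := by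
  have step : ∀ (n : ℕ) (x : D), ∃ x' : D, G x' + κ * ρ x x' ≤ G x ∧
      ∀ z ∈ D, G z + κ * ρ x z ≤ G x → G x' ≤ G z + 1 / ((n : ℝ) + 1) := by
    intro n x
    set T : Set ℝ := G '' {z | z ∈ D ∧ G z + κ * ρ x z ≤ G x} with hT
    have hbT : BddBelow T := by
      refine ⟨m, ?_⟩
      rintro _ ⟨z, hz, rfl⟩
      exact hm z hz.1
    have hTne : T.Nonempty := ⟨G x, x, ⟨x.2, by simp [h.refl x (hDS x.2)]⟩, rfl⟩
    obtain ⟨_, ⟨x', hx', rfl⟩, hlt⟩ := exists_lt_of_csInf_lt hTne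
      (lt_add_of_pos_right (sInf T) (by positivity : (0 : ℝ) < 1 / ((n : ℝ) + 1)))
    refine ⟨⟨x', hx'.1⟩, hx'.2, fun z hz hz' => hlt.le.trans ?_⟩
    gcongr
    exact csInf_le hbT ⟨z, ⟨hz, hz'⟩, rfl⟩
  choose f hf1 hf2 using step
  obtain ⟨xs, hxs0, hxs⟩ : ∃ xs : ℕ → D, xs 0 = ⟨z₀, hz₀⟩ ∧ ∀ n, xs (n + 1) = f n (xs n) :=
    ⟨fun n => Nat.rec ⟨z₀, hz₀⟩ (fun n x => f n x) n, rfl, fun _ => rfl⟩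
  have hS : ∀ n, (xs n : Y) ∈ S := fun n => hDS (xs n).2
  have hdec : ∀ n k, G (xs (n + k)) + κ * ρ (xs n) (xs (n + k)) ≤ G (xs n) := by
    intro n k
    induction k with
    | zero => simp [h.refl _ (hS n)]
    | succ k ih =>
      have h1 := hf1 (n + k) (xs (n + k))
      rw [← hxs] at h1
      have h2 := h.triangle _ (hS n) _ (hS (n + k)) _ (hS (n + k + 1))
      have h3 := mul_le_mul_of_nonneg_left h2 hκ.le
      rw [← add_assoc]
      linarith
  have hanti : Antitone fun n => G (xs n) := antitone_nat_of_succ_le fun n => by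
    have := hdec n 1
    have := mul_nonneg hκ.le (h.nonneg (hS n) (hS (n + 1)))
    linarith
  have hconv : CauchySeq fun n => G (xs n) :=
    (tendsto_atTop_ciInf hanti ⟨m, by rintro _ ⟨n, rfl⟩; exact hm _ (xs n).2⟩).cauchySeq
  have hcau : CauchySeq fun n => (xs n : Y) := by
    refine Metric.cauchySeq_iff'.2 fun ε hε => ?_
    obtain ⟨N, hN⟩ := Metric.cauchySeq_iff'.1 hconv (κ * ε) (by positivity)
    refine ⟨N, fun n hn => ?_⟩
    obtain ⟨k, rfl⟩ := Nat.exists_eq_add_of_le hn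
    have h1 := hN _ hn
    rw [Real.dist_eq, abs_sub_comm] at h1
    have h2 := (le_abs_self _).trans_lt h1
    have h3 := hdec N k
    have h4 : κ * ρ (xs N) (xs (N + k)) < κ * ε := by linarith
    rw [dist_comm]
    exact (h.ge_dist _ (hS N) _ (hS (N + k))).trans_lt (lt_of_mul_lt_mul_left h4 hκ.le)
  obtain ⟨z, hz⟩ := cauchySeq_tendsto_of_complete hcau
  have hzD : z ∈ D := hD.mem_of_tendsto hz (Eventually.of_forall fun n => (xs n).2)
  have hzS := hDS hzD
  have hlim : ∀ n, G z + κ * ρ (xs n) z ≤ G (xs n) := by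
    intro n
    have hρ : Tendsto (fun k => ρ (xs n) (xs k)) atTop (𝓝 (ρ (xs n) z)) :=
      (h.continuousOn (hS n) z hzS).tendsto.comp
        (tendsto_nhdsWithin_iff.2 ⟨hz, Eventually.of_forall hS⟩)
    refine le_of_forall_lt_imp_le_of_dense fun c hc => ?_
    have hev := (tendsto_nhdsWithin_iff.2 ⟨hz, Eventually.of_forall fun k => (xs k).2⟩ :
      Tendsto (fun k => (xs k : Y)) atTop (𝓝[D] z)).eventually
      (hG z hzD (c - κ * ρ (xs n) z) (by linarith))
    have h1 : c - κ * ρ (xs n) z ≤ G (xs n) - κ * ρ (xs n) z := by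
      refine le_of_tendsto_of_tendsto tendsto_const_nhds
        (tendsto_const_nhds.sub (hρ.const_mul κ)) ?_
      filter_upwards [hev, eventually_ge_atTop n] with k hk hnk
      obtain ⟨j, rfl⟩ := Nat.exists_eq_add_of_le hnk
      linarith [hdec n j]
    linarith
  refine ⟨z, hzD, ?_, fun w hw => ?_⟩
  · have := hlim 0
    have h0 := mul_nonneg hκ.le (h.nonneg (hS 0) hzS)
    have e : (xs 0 : Y) = z₀ := by rw [hxs0]
    rw [e] at this h0
    linarith
  · by_contra! hlt
    have hwS := hDS hw
    have hle : ∀ n : ℕ, G z ≤ G w + 1 / ((n : ℝ) + 1) := by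
      intro n
      have h1 := hlim n
      have h2 := mul_le_mul_of_nonneg_left (h.triangle _ (hS n) z hzS w hwS) hκ.le
      have h3 := hf2 n (xs n) w hw (by linarith)
      rw [← hxs] at h3
      have h4 := hlim (n + 1)
      have h5 := mul_nonneg hκ.le (h.nonneg (hS (n + 1)) hzS)
      linarith
    have hle' : G z ≤ G w := by
      have := ge_of_tendsto' (tendsto_const_nhds.add tendsto_one_div_add_atTop_nhds_zero_nat) hle
      simpa using this
    have := mul_nonneg hκ.le (h.nonneg hzS hwS)
    linarith

/-- Tests a supersolution with a perturbed cone centred at `y`. -/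
theorem IsMVSupersolutionWrt.exists_cone_touching [CompleteSpace Y] (hS : IsClosed S)
    (h : IsMetricOn S ρ) (hg : IsGeodesicWrt S ρ) {H : Y → ℝ → ℝ → ℝ} {u : Y → ℝ}
    (hsup : IsMVSupersolutionWrt S ρ H u) {C : ℝ} (hu : ∀ x ∈ S, |u x| ≤ C)
    {x₀ y z₀ : Y} (hx₀ : x₀ ∈ S) (hy : y ∈ S) (hz₀ : z₀ ∈ S) {p A κ τ r R : ℝ} (hp : 0 ≤ p)
    (hA : 0 ≤ A) (hκ : 0 < κ) (hτ : 0 < τ) (hz₀R : ρ x₀ z₀ ≤ R) {G : Y → ℝ}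
    (hGdef : ∀ z, G z = lscWrt S u z + p * √(ρ y z ^ 2 + τ ^ 2) + A * |ρ y z - r|)
    (hR : ∀ z ∈ S, ρ x₀ z ≤ R → G z ≤ G z₀ → ρ x₀ z < R) :
    ∃ z ∈ S, ρ x₀ z < R ∧ G z ≤ G z₀ ∧ ∃ a, 0 ≤ a ∧ a ≤ A + κ ∧
      0 ≤ Hupp H a z (lscWrt S u z) (p * (ρ y z / √(ρ y z ^ 2 + τ ^ 2))) := by
  have hGl : LowerSemicontinuousOn G S := by
    have hc := h.continuousOn hy
    have h1 : ContinuousOn (fun z => p * √(ρ y z ^ 2 + τ ^ 2) + A * |ρ y z - r|) S :=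
      (continuousOn_const.mul ((hc.pow 2).add continuousOn_const).sqrt).add
        (continuousOn_const.mul (hc.sub continuousOn_const).abs)
    have h2 := (lowerSemicontinuousOn_lscWrt hu).add h1.lowerSemicontinuousOn
    have e : G = fun z => lscWrt S u z + (p * √(ρ y z ^ 2 + τ ^ 2) + A * |ρ y z - r|) := by
      funext z; rw [hGdef, add_assoc]
    rw [e]; exact h2
  have hDS : {z | z ∈ S ∧ ρ x₀ z ≤ R} ⊆ S := fun z hz => hz.1
  have hGm : ∀ z ∈ {z | z ∈ S ∧ ρ x₀ z ≤ R}, -C ≤ G z := by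
    intro z hz
    have h1 := (abs_le.1 (abs_lscWrt_le hu hz.1)).1
    have h2 : 0 ≤ p * √(ρ y z ^ 2 + τ ^ 2) := by positivity
    have h3 : 0 ≤ A * |ρ y z - r| := by positivity
    rw [hGdef]; linarith
  obtain ⟨z, ⟨hz, hzR⟩, hz1, hz2⟩ := h.ekeland hDS (h.isClosed_closedBall hS hx₀ R)
    (hGl.mono hDS) hGm hκ (show z₀ ∈ {z | z ∈ S ∧ ρ x₀ z ≤ R} from ⟨hz₀, hz₀R⟩)
  have hlt := hR z hz hzR hz1
  have hlip : ∀ w ∈ S, ∀ w' ∈ S, |-(A * |ρ y w - r| + κ * ρ z w) -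
      -(A * |ρ y w' - r| + κ * ρ z w')| ≤ (A + κ) * ρ w w' := by
    intro w hw w' hw'
    have e : -(A * |ρ y w - r| + κ * ρ z w) - -(A * |ρ y w' - r| + κ * ρ z w') =
      -(A * (|ρ y w - r| - |ρ y w' - r|)) + -(κ * (ρ z w - ρ z w')) := by ring
    have h1 : |(|ρ y w - r| - |ρ y w' - r|)| ≤ ρ w w' := by
      refine (abs_abs_sub_abs_le_abs_sub _ _).trans ?_
      rw [sub_sub_sub_cancel_right]
      exact h.abs_sub_le hy hw hw'
    have h2 := h.abs_sub_le hz hw hw'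
    rw [e]
    refine (abs_add_le _ _).trans ?_
    rw [abs_neg, abs_neg, abs_mul, abs_mul, abs_of_nonneg hA, abs_of_pos hκ, add_mul]
    gcongr
  refine ⟨z, hz, hlt, hz1, uscWrt S (slopeWrt S ρ fun w => -(A * |ρ y w - r| + κ * ρ z w)) z,
    ?_, ?_, ?_⟩
  · refine limsup_nonneg_of_eventually_nonneg ?_
    filter_upwards [self_mem_nhdsWithin] with w hw using slopeWrt_nonneg h hw _
  · refine limsup_le_of_eventually_le_of_nonneg (by positivity) ?_ ?_
    · filter_upwards [self_mem_nhdsWithin] with w hw using slopeWrt_nonneg h hw _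
    · filter_upwards [self_mem_nhdsWithin] with w hw
      refine slopeWrt_le h hw (by positivity) ?_
      filter_upwards [self_mem_nhdsWithin] with w' hw'
      rw [h.symm w hw w' hw']
      exact hlip w' hw' w hw
  · have := hsup _ _ (smoothedCone_isC1Plus h hg hy hp hτ) (locLipWrt_of_lipschitz hlip) z hz ?_
    · rwa [(smoothedCone_slope h hg hy hp hτ hz).1] at this
    · have hnhd : ∀ᶠ w in 𝓝[S] z, ρ x₀ w < R :=
        (h.continuousOn hx₀ z hz).tendsto.eventually_lt_const hlt
      filter_upwards [hnhd, self_mem_nhdsWithin] with w hw hwS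
      have h1 := hz2 w ⟨hwS, hw.le⟩
      rw [hGdef, hGdef] at h1
      rw [h.refl z hz]
      linarith

end Metric

section Sequences

theorem tendsto_extend_of_strictMono {α : Type*} {l : Filter α} {φ : ℕ → ℕ} (hφ : StrictMono φ)
    {z x : ℕ → α} (hz : Tendsto z atTop l) (hx : Tendsto x atTop l) :
    Tendsto (Function.extend φ z x) atTop l := by
  intro U hU
  obtain ⟨M, hM⟩ := eventually_atTop.1 (hz hU)
  obtain ⟨N, hN⟩ := eventually_atTop.1 (hx hU)
  refine eventually_atTop.2 ⟨max N (φ M), fun n hn => ?_⟩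
  by_cases h : ∃ m, φ m = n
  · obtain ⟨m, rfl⟩ := h
    rw [hφ.injective.extend_apply]
    exact hM m (hφ.le_iff_le.1 ((le_max_right _ _).trans hn))
  · rw [Function.extend_apply' _ _ _ h]
    exact hN n ((le_max_left _ _).trans hn)

theorem extend_induction {α : Type*} {φ : ℕ → ℕ} (hφ : StrictMono φ) {z x : ℕ → α}
    {P : ℕ → α → Prop} (hz : ∀ m, P (φ m) (z m)) (hx : ∀ n, P n (x n)) (n : ℕ) :
    P n (Function.extend φ z x n) := by
  by_cases h : ∃ m, φ m = n
  · obtain ⟨m, rfl⟩ := h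
    rw [hφ.injective.extend_apply]; exact hz m
  · rw [Function.extend_apply' _ _ _ h]; exact hx n

variable {Y : Type*} [MetricSpace Y] {X : ℕ → Set Y} {Xi : Set Y}

theorem tendsto_of_dist_lt_one_div {z : ℕ → Y} {x : Y}
    (h : ∀ m : ℕ, dist (z m) x < 1 / ((m : ℝ) + 1)) : Tendsto z atTop (𝓝 x) :=
  tendsto_iff_dist_tendsto_zero.2 (squeeze_zero (fun _ => dist_nonneg) (fun m => (h m).le)
    tendsto_one_div_add_atTop_nhds_zero_nat)

/-- Continuous convergence of the metrics, in neighbourhood form. -/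
theorem eventually_abs_metric_sub_lt {d : ℕ → Y → Y → ℝ} {di : Y → Y → ℝ}
    (h2 : ∀ a ∈ Xi, ∀ b ∈ Xi, ∀ an bn : ℕ → Y, (∀ n, an n ∈ X n) → (∀ n, bn n ∈ X n) →
      Tendsto an atTop (𝓝 a) → Tendsto bn atTop (𝓝 b) →
      Tendsto (fun n => d n (an n) (bn n)) atTop (𝓝 (di a b)))
    {x y : Y} (hx : x ∈ Xi) (hy : y ∈ Xi) {xs ys : ℕ → Y} (hxs : ∀ n, xs n ∈ X n)
    (hys : ∀ n, ys n ∈ X n) (hxt : Tendsto xs atTop (𝓝 x)) (hyt : Tendsto ys atTop (𝓝 y))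
    {τ : ℝ} (hτ : 0 < τ) :
    ∃ θ > 0, ∀ᶠ n in atTop, ∀ z ∈ X n, dist z x < θ → |d n (ys n) z - di y x| < τ := by
  by_contra! hcon
  have hfr : ∀ m : ℕ, ∃ᶠ n in atTop, ∃ z ∈ X n, dist z x < 1 / ((m : ℝ) + 1) ∧
      τ ≤ |d n (ys n) z - di y x| := fun m =>
    hcon _ (by positivity)
  obtain ⟨φ, hφ, hz⟩ := extraction_forall_of_frequently hfr
  choose z hzX hzd hzτ using hz
  have hlim := (h2 y hy x hx ys _ hys
    (extend_induction hφ (P := fun n w => w ∈ X n) hzX hxs) hyt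
    (tendsto_extend_of_strictMono hφ (tendsto_of_dist_lt_one_div hzd) hxt)).comp hφ.tendsto_atTop
  have := (Metric.tendsto_nhds.1 hlim τ hτ).exists
  obtain ⟨m, hm⟩ := this
  simp only [Function.comp, hφ.injective.extend_apply, Real.dist_eq] at hm
  exact (hzτ m).not_gt hm

/-- Continuous convergence of the Hamiltonians, in neighbourhood form. -/
theorem eventually_Hupp_neg {H : ℕ → Y → ℝ → ℝ → ℝ} {Hi : Y → ℝ → ℝ → ℝ}
    (hHic : ContinuousOn (fun q : Y × ℝ × ℝ => Hi q.1 q.2.1 q.2.2)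
      (Xi ×ˢ (univ : Set ℝ) ×ˢ Ici (0:ℝ)))
    (h3 : ∀ x ∈ Xi, ∀ xn : ℕ → Y, (∀ n, xn n ∈ X n) → Tendsto xn atTop (𝓝 x) →
      ∀ r p : ℝ, 0 ≤ p → ∀ rn pn : ℕ → ℝ, (∀ n, 0 ≤ pn n) →
      Tendsto rn atTop (𝓝 r) → Tendsto pn atTop (𝓝 p) →
      Tendsto (fun n => H n (xn n) (rn n) (pn n)) atTop (𝓝 (Hi x r p)))
    {x : Y} (hx : x ∈ Xi) {xs : ℕ → Y} (hxs : ∀ n, xs n ∈ X n) (hxt : Tendsto xs atTop (𝓝 x))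
    {a r p : ℝ} (hneg : Hupp Hi a x r p < 0) :
    ∃ θ > 0, ∀ᶠ n in atTop, ∀ z ∈ X n, dist z x < θ → ∀ s, |s - r| < θ → ∀ a' p', 0 ≤ a' →
      0 ≤ p' → |p' - p| + a' < a + θ → Hupp (H n) a' z s p' < 0 := by
  set c := Hupp Hi a x r p with hc
  by_contra! hcon
  have hfr : ∀ m : ℕ, ∃ᶠ n in atTop, ∃ z ∈ X n, dist z x < 1 / ((m : ℝ) + 1) ∧
      ∃ s, |s - r| < 1 / ((m : ℝ) + 1) ∧ ∃ q, 0 ≤ q ∧ |q - p| < a + 1 / ((m : ℝ) + 1) ∧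
        c / 2 < H n z s q := by
    intro m
    have := hcon _ (by positivity : (0 : ℝ) < 1 / ((m : ℝ) + 1))
    refine this.mono fun n hn => ?_
    obtain ⟨z, hz, hzd, s, hs, a', p', ha', hp', hap, hH⟩ := hn
    refine ⟨z, hz, hzd, s, hs, ?_⟩
    by_contra! hq
    have : Hupp (H n) a' z s p' ≤ c / 2 := by
      refine csSup_le ⟨_, p', ⟨hp', by simpa using ha'⟩, rfl⟩ ?_
      rintro _ ⟨q, ⟨hq0, hqa⟩, rfl⟩
      refine hq q hq0 (lt_of_le_of_lt ?_ hap)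
      have := abs_sub_le q p' p
      linarith
    linarith
  obtain ⟨φ, hφ, hz⟩ := extraction_forall_of_frequently hfr
  choose z hzX hzd s hs q hq0 hqp hqH using hz
  have hone : ∀ m : ℕ, 1 / ((m : ℝ) + 1) ≤ 1 := fun m => by
    rw [div_le_one (by positivity)]; linarith [Nat.cast_nonneg (α := ℝ) m]
  have hqI : ∀ m, q m ∈ Icc (p - (a + 1)) (p + (a + 1)) := fun m => by
    have := abs_lt.1 (hqp m)
    have := hone m
    constructor <;> linarith
  obtain ⟨q', -, σ, hσ, hqt⟩ := isCompact_Icc.tendsto_subseq hqI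
  have hq'0 : 0 ≤ q' := ge_of_tendsto' hqt fun m => hq0 _
  have hinv : Tendsto (fun m : ℕ => 1 / ((m : ℝ) + 1)) atTop (𝓝 0) :=
    tendsto_one_div_add_atTop_nhds_zero_nat
  have hq'a : |q' - p| ≤ a := by
    have h1 : Tendsto (fun m => |q (σ m) - p|) atTop (𝓝 |q' - p|) := (hqt.sub_const p).abs
    have h2 : Tendsto (fun m => a + 1 / ((σ m : ℝ) + 1)) atTop (𝓝 (a + 0)) :=
      (hinv.comp hσ.tendsto_atTop).const_add a
    rw [add_zero] at h2
    exact le_of_tendsto_of_tendsto' h1 h2 fun m => (hqp _).le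
  have hst : Tendsto s atTop (𝓝 r) :=
    tendsto_of_dist_lt_one_div fun m => by rw [Real.dist_eq]; exact hs m
  have hψ := hφ.comp hσ
  have hlim := (h3 x hx _ (extend_induction hψ (z := z ∘ σ) (P := fun n w => w ∈ X n)
      (fun m => hzX _) hxs)
    (tendsto_extend_of_strictMono hψ ((tendsto_of_dist_lt_one_div hzd).comp hσ.tendsto_atTop) hxt)
    r q' hq'0 _ _ (extend_induction hψ (z := q ∘ σ) (P := fun _ w => 0 ≤ w)
      (fun m => hq0 _) fun _ => hq'0)
    (tendsto_extend_of_strictMono hψ (hst.comp hσ.tendsto_atTop) tendsto_const_nhds)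
    (tendsto_extend_of_strictMono hψ hqt tendsto_const_nhds)).comp hψ.tendsto_atTop
  have h1 : c / 2 ≤ Hi x r q' := by
    refine ge_of_tendsto' hlim fun m => ?_
    change c / 2 ≤ H ((φ ∘ σ) m) (Function.extend (φ ∘ σ) _ _ ((φ ∘ σ) m))
      (Function.extend (φ ∘ σ) _ _ ((φ ∘ σ) m)) (Function.extend (φ ∘ σ) _ _ ((φ ∘ σ) m))
    rw [hψ.injective.extend_apply, hψ.injective.extend_apply, hψ.injective.extend_apply]
    exact (hqH _).le
  have h2 : Hi x r q' ≤ c := by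
    refine le_csSup ?_ ⟨q', ⟨hq'0, hq'a⟩, rfl⟩
    have hcomp : IsCompact {q : ℝ | 0 ≤ q ∧ |q - p| ≤ a} := by
      have e : {q : ℝ | 0 ≤ q ∧ |q - p| ≤ a} = Icc (p - a) (p + a) ∩ Ici 0 := by
        ext q
        simp only [mem_ofPred_eq, mem_inter_iff, mem_Icc, mem_Ici, abs_le]
        constructor
        · rintro ⟨h0, h1, h2⟩; exact ⟨⟨by linarith, by linarith⟩, h0⟩
        · rintro ⟨⟨h1, h2⟩, h0⟩; exact ⟨h0, by linarith, by linarith⟩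
      rw [e]; exact isCompact_Icc.inter_right isClosed_Ici
    refine (hcomp.image_of_continuousOn ?_).bddAbove
    exact hHic.comp (f := fun q : ℝ => (x, r, q)) (by fun_prop)
      fun q hq => ⟨hx, mem_univ _, hq.1⟩
  linarith

/-- The lower semilimit of a sequence of functions defined on converging sets. -/
noncomputable def lowerSemilimit (X : ℕ → Set Y) (u : ℕ → Y → ℝ) (x : Y) : ℝ :=
  sInf {L : ℝ | ∃ xn : ℕ → Y, (∀ n, xn n ∈ X n) ∧ Tendsto xn atTop (𝓝 x) ∧
    Filter.liminf (fun n => u n (xn n)) atTop = L}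

section LowerSemilimit

variable {u : ℕ → Y → ℝ} {C : ℝ}

theorem abs_liminf_le {f : ℕ → ℝ} (hf : ∀ n, |f n| ≤ C) : |liminf f atTop| ≤ C := by
  have hb : atTop.IsBoundedUnder (· ≤ ·) f :=
    ⟨C, eventually_map.2 (Eventually.of_forall fun n => (abs_le.1 (hf n)).2)⟩
  have hb' : atTop.IsBoundedUnder (· ≥ ·) f :=
    ⟨-C, eventually_map.2 (Eventually.of_forall fun n => (abs_le.1 (hf n)).1)⟩
  refine abs_le.2 ⟨le_liminf_of_le hb.isCoboundedUnder_ge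
    (Eventually.of_forall fun n => (abs_le.1 (hf n)).1), ?_⟩
  exact liminf_le_of_frequently_le (Frequently.of_forall fun n => (abs_le.1 (hf n)).2) hb'

theorem lowerSemilimit_le (hu : ∀ n, ∀ x ∈ X n, |u n x| ≤ C) {x : Y} {xs : ℕ → Y}
    (hxs : ∀ n, xs n ∈ X n) (hxt : Tendsto xs atTop (𝓝 x)) :
    lowerSemilimit X u x ≤ liminf (fun n => u n (xs n)) atTop := by
  refine csInf_le ⟨-C, ?_⟩ ⟨xs, hxs, hxt, rfl⟩
  rintro _ ⟨zs, hzs, -, rfl⟩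
  exact (abs_le.1 (abs_liminf_le fun n => hu n _ (hzs n))).1

theorem abs_lowerSemilimit_le (hu : ∀ n, ∀ x ∈ X n, |u n x| ≤ C) {x : Y} {xs : ℕ → Y}
    (hxs : ∀ n, xs n ∈ X n) (hxt : Tendsto xs atTop (𝓝 x)) : |lowerSemilimit X u x| ≤ C := by
  refine abs_le.2 ⟨le_csInf ⟨_, xs, hxs, hxt, rfl⟩ ?_, (lowerSemilimit_le hu hxs hxt).trans
    (abs_le.1 (abs_liminf_le fun n => hu n _ (hxs n))).2⟩
  rintro _ ⟨zs, hzs, -, rfl⟩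
  exact (abs_le.1 (abs_liminf_le fun n => hu n _ (hzs n))).1

theorem eventually_lt_lscWrt (hu : ∀ n, ∀ x ∈ X n, |u n x| ≤ C) {x : Y} {xs : ℕ → Y}
    (hxs : ∀ n, xs n ∈ X n) (hxt : Tendsto xs atTop (𝓝 x)) {b : ℝ}
    (hb : b < lowerSemilimit X u x) : ∀ᶠ n in atTop, b < lscWrt (X n) (u n) (xs n) := by
  obtain ⟨b', hbb', hb'⟩ := exists_between hb
  have hex : ∀ n, ∃ z ∈ X n, dist z (xs n) < 1 / ((n : ℝ) + 1) ∧
      u n z < lscWrt (X n) (u n) (xs n) + (b' - b) := by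
    intro n
    have h1 := frequently_lt_of_lscWrt_lt (hu n) (hxs n)
      (lt_add_of_pos_right (lscWrt (X n) (u n) (xs n)) (sub_pos.2 hbb'))
    have h2 : ∀ᶠ z in 𝓝[X n] (xs n), z ∈ X n ∧ dist z (xs n) < 1 / ((n : ℝ) + 1) := by
      filter_upwards [self_mem_nhdsWithin, mem_nhdsWithin_of_mem_nhds
        (Metric.ball_mem_nhds (xs n) (by positivity : (0 : ℝ) < 1 / ((n : ℝ) + 1)))] with z h1 h2
      exact ⟨h1, h2⟩
    obtain ⟨z, hz1, hz2, hz3⟩ := (h1.and_eventually h2).exists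
    exact ⟨z, hz2, hz3, hz1⟩
  choose z hz hzd hzu using hex
  have hzt : Tendsto z atTop (𝓝 x) := by
    refine (tendsto_iff_of_dist ?_).2 hxt
    exact squeeze_zero (fun _ => dist_nonneg) (fun n => (hzd n).le)
      tendsto_one_div_add_atTop_nhds_zero_nat
  have := eventually_lt_of_lt_liminf (hb'.trans_le (lowerSemilimit_le hu hz hzt))
    ⟨-C, eventually_map.2 (Eventually.of_forall fun n => (abs_le.1 (hu n _ (hz n))).1)⟩
  filter_upwards [this] with n hn
  linarith [hzu n]

theorem exists_frequently_lt (hu : ∀ n, ∀ x ∈ X n, |u n x| ≤ C) {x : Y} {xs : ℕ → Y}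
    (hxs : ∀ n, xs n ∈ X n) (hxt : Tendsto xs atTop (𝓝 x)) {b : ℝ}
    (hb : lowerSemilimit X u x < b) : ∃ zs : ℕ → Y, (∀ n, zs n ∈ X n) ∧
      Tendsto zs atTop (𝓝 x) ∧ ∃ᶠ n in atTop, u n (zs n) < b := by
  unfold lowerSemilimit at hb
  obtain ⟨_, ⟨zs, hzs, hzt, rfl⟩, hlt⟩ :=
    exists_lt_of_csInf_lt (by exact ⟨_, xs, hxs, hxt, rfl⟩) hb
  refine ⟨zs, hzs, hzt, frequently_lt_of_liminf_lt ?_ hlt⟩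
  exact IsBoundedUnder.isCoboundedUnder_ge
    ⟨C, eventually_map.2 (Eventually.of_forall fun n => (abs_le.1 (hu n _ (hzs n))).2)⟩

end LowerSemilimit

theorem exists_seq_tendsto_of_hausdorffDist (h1fin : ∀ n, hausdorffEDist (X n) Xi ≠ ⊤)
    (hXne : ∀ n, (X n).Nonempty)
    (h1 : Tendsto (fun n => hausdorffDist (X n) Xi) atTop (𝓝 0)) {x : Y} (hx : x ∈ Xi) :
    ∃ xs : ℕ → Y, (∀ n, xs n ∈ X n) ∧ Tendsto xs atTop (𝓝 x) := by
  have hex : ∀ n, ∃ z ∈ X n, dist x z < hausdorffDist (X n) Xi + 1 / ((n : ℝ) + 1) := by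
    intro n
    rw [← infDist_lt_iff (hXne n), hausdorffDist_comm]
    refine lt_of_le_of_lt (infDist_le_hausdorffDist_of_mem hx ?_)
      (lt_add_of_pos_right _ (by positivity))
    rw [hausdorffEDist_comm]; exact h1fin n
  choose z hz hzd using hex
  refine ⟨z, hz, tendsto_iff_dist_tendsto_zero.2 ?_⟩
  have := h1.add tendsto_one_div_add_atTop_nhds_zero_nat
  rw [add_zero] at this
  exact squeeze_zero (fun _ => dist_nonneg) (fun n => by rw [dist_comm]; exact (hzd n).le) this


/-- Infima over balls pass to the limit, hence so do cone-type lower bounds. -/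
theorem exists_eventually_cone_le_lscWrt {d : ℕ → Y → Y → ℝ} {di : Y → Y → ℝ}
    (hmet : ∀ n, IsMetricOn (X n) (d n)) (hmeti : IsMetricOn Xi di)
    (h2 : ∀ a ∈ Xi, ∀ b ∈ Xi, ∀ an bn : ℕ → Y, (∀ n, an n ∈ X n) → (∀ n, bn n ∈ X n) →
      Tendsto an atTop (𝓝 a) → Tendsto bn atTop (𝓝 b) →
      Tendsto (fun n => d n (an n) (bn n)) atTop (𝓝 (di a b)))
    (h4m : ∀ a ∈ Xi, ∀ an : ℕ → Y, (∀ n, an n ∈ X n) → Tendsto an atTop (𝓝 a) →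
      ∀ φn : ℕ → Y → ℝ, ∀ φi : Y → ℝ,
      (∃ C : ℝ, ∀ n, ∀ x ∈ X n, |φn n x| ≤ C) → (∃ C : ℝ, ∀ x ∈ Xi, |φi x| ≤ C) →
      (∀ n, LowerSemicontinuousOn (φn n) (X n)) → LowerSemicontinuousOn φi Xi →
      (∀ x ∈ Xi, ∀ xn : ℕ → Y, (∀ n, xn n ∈ X n) → Tendsto xn atTop (𝓝 x) →
        φi x ≤ Filter.liminf (fun n => φn n (xn n)) atTop) →
      ∃ δ : ℝ, 0 < δ ∧ ∀ r : ℝ, 0 < r → r < δ →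
        sInf (φi '' {x | x ∈ Xi ∧ di a x ≤ r}) ≤
          Filter.liminf (fun n => sInf (φn n '' {x | x ∈ X n ∧ d n (an n) x ≤ r})) atTop)
    {u : ℕ → Y → ℝ} {C : ℝ} (hu : ∀ n, ∀ x ∈ X n, |u n x| ≤ C)
    {x : Y} (hx : x ∈ Xi) {xs : ℕ → Y} (hxs : ∀ n, xs n ∈ X n) (hxt : Tendsto xs atTop (𝓝 x))
    {w L k r₀ : ℝ} (hL : 0 ≤ L) (hr₀ : 0 < r₀) {y : ℕ → Y} (hy : ∀ j, y j ∈ Xi)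
    {ys : ℕ → ℕ → Y} (hys : ∀ j n, ys j n ∈ X n) (hyt : ∀ j, Tendsto (ys j) atTop (𝓝 (y j)))
    {r : ℕ → ℝ} (hr0 : ∀ j, 0 ≤ r j) (hr1 : ∀ j, r j ≤ 1) (hrt : Tendsto r atTop (𝓝 0))
    (hxy : ∀ j n, d n (xs n) (ys j n) ≤ 2 * r j)
    (hlow : ∀ z ∈ Xi, di x z < r₀ → ∀ j, w + k * r j - L * di (y j) z ≤ lowerSemilimit X u z)
    (hlow0 : ∀ z ∈ Xi, di x z < r₀ → w - L * di x z ≤ lowerSemilimit X u z) :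
    ∃ R > 0, ∀ τ > 0, ∀ᶠ n in atTop, ∀ z ∈ X n, d n (xs n) z ≤ R → ∀ j,
      w - τ + k * r j - L * d n (ys j n) z ≤ lscWrt (X n) (u n) z := by
  set g : ℕ → Y → ℝ := fun n z => ⨅ j, (L * d n (ys j n) z - k * r j) with hg
  set φn : ℕ → Y → ℝ := fun n z => min w (lscWrt (X n) (u n) z + g n z) with hφn
  set K := C + |k| + |w| with hK
  have hC : 0 ≤ C := (abs_nonneg _).trans (hu 0 _ (hxs 0))
  have hkr : ∀ j, k * r j ≤ |k| := fun j =>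
    (mul_le_mul_of_nonneg_right (le_abs_self k) (hr0 j)).trans
      (mul_le_of_le_one_right (abs_nonneg k) (hr1 j))
  have hterm : ∀ n, ∀ z ∈ X n, ∀ j, -|k| ≤ L * d n (ys j n) z - k * r j := fun n z hz j => by
    have := mul_nonneg hL ((hmet n).nonneg (hys j n) hz)
    linarith [hkr j]
  have hbdd : ∀ n, ∀ z ∈ X n, BddBelow (range fun j => L * d n (ys j n) z - k * r j) := by
    rintro n z hz
    refine ⟨-|k|, ?_⟩
    rintro _ ⟨j, rfl⟩
    exact hterm n z hz j
  have hgk : ∀ n, ∀ z ∈ X n, -|k| ≤ g n z := fun n z hz => le_ciInf (hterm n z hz)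
  have hgle : ∀ n, ∀ z ∈ X n, ∀ j, g n z ≤ L * d n (ys j n) z - k * r j :=
    fun n z hz j => ciInf_le (hbdd n z hz) j
  have hglip : ∀ n, ∀ z ∈ X n, ∀ z' ∈ X n, g n z - L * d n z z' ≤ g n z' := by
    intro n z hz z' hz'
    refine le_ciInf fun j => ?_
    have h1 := (hmet n).triangle _ (hys j n) z' hz' z hz
    rw [(hmet n).symm z' hz' z hz] at h1
    have := mul_le_mul_of_nonneg_left h1 hL
    linarith [hgle n z hz j]
  have hφlow : ∀ n, ∀ z ∈ X n, -K ≤ φn n z := fun n z hz => by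
    refine le_min ?_ ?_
    · linarith [neg_abs_le w, abs_nonneg k]
    · linarith [hgk n z hz, (abs_le.1 (abs_lscWrt_le (hu n) hz)).1, abs_nonneg w]
  have hφup : ∀ n z, φn n z ≤ w := fun n z => min_le_left _ _
  classical
  set φi : Y → ℝ := fun z => if di x z < r₀ then w else -K with hφi
  have hKw : -K ≤ w := by linarith [neg_abs_le w, abs_nonneg k]
  have hwK : w ≤ K := by linarith [le_abs_self w, abs_nonneg k]
  have hφilow : ∀ z, -K ≤ φi z := fun z => by
    simp only [hφi]; split_ifs <;> linarith
  obtain ⟨δ, hδ, hsInf⟩ := h4m x hx xs hxs hxt φn φi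
    ⟨K, fun n z hz => abs_le.2 ⟨hφlow n z hz, (hφup n z).trans hwK⟩⟩
    ⟨K, fun z _ => abs_le.2 ⟨hφilow z, by simp only [hφi]; split_ifs <;> linarith⟩⟩
    (fun n z hz c hc => by
      obtain ⟨hc1, hc2⟩ := lt_min_iff.1 hc
      obtain ⟨η, hη, hcη⟩ : ∃ η > 0, c + 2 * η = lscWrt (X n) (u n) z + g n z :=
        ⟨(lscWrt (X n) (u n) z + g n z - c) / 2, by linarith, by ring⟩
      have hd := ((hmet n).continuousOn hz).const_mul L z hz
      rw [ContinuousWithinAt, (hmet n).refl z hz, mul_zero] at hd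
      filter_upwards [lowerSemicontinuousOn_lscWrt (hu n) z hz _ (sub_lt_self _ hη),
        hd.eventually_lt_const hη, self_mem_nhdsWithin] with z' h1 h1' hz'
      refine lt_min hc1 ?_
      linarith [hglip n z hz z' hz'])
    (fun z hz c hc => by
      by_cases hzr : di x z < r₀
      · have hcw : c < w := by simpa [hφi, hzr] using hc
        filter_upwards [(hmeti.continuousOn hx z hz).eventually_lt_const hzr] with z' hz'
        simpa [hφi, hz'] using hcw
      · have hcw : c < -K := by simpa [hφi, hzr] using hc
        exact Eventually.of_forall fun z' => hcw.trans_le (hφilow z'))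
    (fun z hz zs hzs hzt => by
      have hcob : atTop.IsCoboundedUnder (· ≥ ·) fun n => φn n (zs n) :=
        IsBoundedUnder.isCoboundedUnder_ge
          ⟨w, eventually_map.2 (Eventually.of_forall fun n => hφup n _)⟩
      by_cases hzr : di x z < r₀
      · simp only [hφi, hzr, if_true]
        refine le_of_forall_lt_imp_le_of_dense fun b hb => le_liminf_of_le hcob ?_
        set η := (w - b) / 4 with hη
        have hη0 : 0 < η := by rw [hη]; linarith
        have e1 := eventually_lt_lscWrt hu hzs hzt
          (sub_lt_self (lowerSemilimit X u z) hη0)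
        have e2 : ∀ᶠ n in atTop, L * di x z - η < L * d n (xs n) (zs n) :=
          ((h2 x hx z hz xs zs hxs hzs hxt hzt).const_mul L).eventually_const_lt
            (sub_lt_self _ hη0)
        have e3 : ∀ᶠ j in atTop, (2 * L + |k|) * r j < η := by
          have := hrt.const_mul (2 * L + |k|)
          rw [mul_zero] at this
          exact this.eventually_lt_const hη0
        obtain ⟨J, hJ⟩ := eventually_atTop.1 e3
        have e4 : ∀ᶠ n in atTop, ∀ j ∈ Finset.range J,
            L * di (y j) z - η < L * d n (ys j n) (zs n) := by
          rw [eventually_all_finset]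
          exact fun j _ => ((h2 (y j) (hy j) z hz (ys j) zs (hys j) hzs (hyt j) hzt).const_mul
            L).eventually_const_lt (sub_lt_self _ hη0)
        filter_upwards [e1, e2, e4] with n h1 h2' h4
        refine le_min hb.le ?_
        have : w - lowerSemilimit X u z - 2 * η ≤ g n (zs n) := by
          refine le_ciInf fun j => ?_
          by_cases hj : j < J
          · have := h4 j (Finset.mem_range.2 hj)
            linarith [hlow z hz hzr j]
          · have a1 := hJ j (not_lt.1 hj)
            have a2 := (hmet n).triangle _ (hxs n) _ (hys j n) _ (hzs n)
            have a3 := mul_le_mul_of_nonneg_left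
              (a2.trans (add_le_add_left (hxy j n) _)) hL
            have a4 := mul_le_mul_of_nonneg_right (le_abs_self k) (hr0 j)
            linarith [hlow0 z hz hzr]
        linarith
      · simp only [hφi, hzr, if_false]
        exact le_liminf_of_le hcob (Eventually.of_forall fun n => hφlow n _ (hzs n)))
  have hm : 0 < min δ r₀ := lt_min hδ hr₀
  refine ⟨min δ r₀ / 2, half_pos hm, fun τ hτ => ?_⟩
  have hle := hsInf (min δ r₀ / 2) (half_pos hm) ((half_lt_self hm).trans_le (min_le_left _ _))
  have hw : w ≤ sInf (φi '' {z | z ∈ Xi ∧ di x z ≤ min δ r₀ / 2}) := by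
    refine le_csInf ⟨_, x, ⟨hx, by rw [hmeti.refl x hx]; exact (half_pos hm).le⟩, rfl⟩ ?_
    rintro _ ⟨z, ⟨hz, hzr⟩, rfl⟩
    have : di x z < r₀ := hzr.trans_lt ((half_lt_self hm).trans_le (min_le_right _ _))
    simp [hφi, this]
  have hbd : ∀ n, BddBelow (φn n '' {z | z ∈ X n ∧ d n (xs n) z ≤ min δ r₀ / 2}) := by
    refine fun n => ⟨-K, ?_⟩
    rintro _ ⟨z, ⟨hz, -⟩, rfl⟩
    exact hφlow n z hz
  have hev := eventually_lt_of_lt_liminf ((sub_lt_self w hτ).trans_le (hw.trans hle))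
    ⟨-K, eventually_map.2 (Eventually.of_forall fun n => by
      refine le_csInf ⟨_, xs n, ⟨hxs n, ?_⟩, rfl⟩ ?_
      · rw [(hmet n).refl _ (hxs n)]; exact (half_pos hm).le
      · rintro _ ⟨z, ⟨hz, -⟩, rfl⟩
        exact hφlow n z hz)⟩
  filter_upwards [hev] with n hn z hz hzR j
  have h1 := hn.trans_le (csInf_le (hbd n) ⟨z, ⟨hz, hzR⟩, rfl⟩)
  have h2' := h1.trans_le (min_le_right _ _)
  linarith [hgle n z hz j]

section TestFunction

variable {S : Set Y} {ρ : Y → Y → ℝ}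

theorem uscWrt_slopeWrt_nonneg (h : IsMetricOn S ρ) (u : Y → ℝ) (x : Y) :
    0 ≤ uscWrt S (slopeWrt S ρ u) x := by
  refine limsup_nonneg_of_eventually_nonneg ?_
  filter_upwards [self_mem_nhdsWithin] with y hy using slopeWrt_nonneg h hy u

theorem LocLipWrt.eventually_slopeWrt_lt (h : IsMetricOn S ρ) {u : Y → ℝ} (hu : LocLipWrt S ρ u)
    {x : Y} (hx : x ∈ S) {b : ℝ} (hb : uscWrt S (slopeWrt S ρ u) x < b) :
    ∀ᶠ y in 𝓝[S] x, slopeWrt S ρ u y < b := by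
  obtain ⟨K, hK, ε, hε, hl⟩ := hu.exists_eventually h hx
  refine eventually_lt_of_limsup_lt hb ⟨K, ?_⟩
  rw [eventually_map]
  filter_upwards [h.eventually_lt hx hε] with y hy
  refine slopeWrt_le h hy.1 hK ?_
  filter_upwards [(h.continuousOn hx y hy.1).eventually_lt_const hy.2, self_mem_nhdsWithin]
    with z hz hzS
  rw [h.symm y hy.1 z hzS]
  exact hl z hzS y hy.1 hz hy.2

theorem LocLipWrt.exists_lipschitz_of_eventually_slopeWrt_lt (h : IsMetricOn S ρ)
    (hg : IsGeodesicWrt S ρ) {u : Y → ℝ} (hu : LocLipWrt S ρ u) {x : Y} (hx : x ∈ S) {K : ℝ}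
    (hK : ∀ᶠ y in 𝓝[S] x, slopeWrt S ρ u y < K) :
    ∃ R > 0, ∀ y ∈ S, ∀ z ∈ S, ρ x y < R → ρ x z < R → u z - u y ≤ K * ρ y z := by
  obtain ⟨R, hR, hs⟩ := h.exists_of_eventually hx hK
  exact ⟨R / 3, by positivity, fun y hy z hz hyR hzR =>
    hu.lipschitz_of_slope_lt h hg hx hs hy hz hyR hzR⟩

theorem frequently_lt_of_lt_upperSlopeWrt (h : IsMetricOn S ρ) {u : Y → ℝ} {x : Y} (hx : x ∈ S)
    {K : ℝ} (hK : K < upperSlopeWrt S ρ u x) (hpos : 0 < upperSlopeWrt S ρ u x) :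
    ∃ᶠ y in 𝓝[S] x, K * ρ x y ≤ u y - u x ∧ x ≠ y := by
  intro hcon
  obtain ⟨K', hK'1, hK'2⟩ := exists_between (max_lt hK hpos)
  refine hK'2.not_ge (upperSlopeWrt_le h hx ((le_max_right _ _).trans hK'1.le) ?_)
  filter_upwards [hcon, self_mem_nhdsWithin] with y hy hyS
  by_cases hxy : x = y
  · subst hxy
    simp [h.refl x hx]
  · have : u y - u x < K * ρ x y := not_le.1 fun h' => hy ⟨h', hxy⟩
    exact this.le.trans (mul_le_mul_of_nonneg_right ((le_max_left _ _).trans hK'1.le)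
      (h.nonneg hx hyS))

/-- A test function is bounded below by cones with vertices at `x` and at points near `x` in the
direction of steepest ascent. -/
theorem exists_cones_le_test (h : IsMetricOn S ρ) (hg : IsGeodesicWrt S ρ) {ψ₁ ψ₂ : Y → ℝ}
    (h₁ : IsC1PlusWrt S ρ ψ₁) (h₂ : LocLipWrt S ρ ψ₂) {x : Y} (hx : x ∈ S) {p a ε : ℝ}
    (hp : slopeWrt S ρ ψ₁ x = p) (ha : uscWrt S (slopeWrt S ρ ψ₂) x = a) (hε : 0 < ε) :
    ∃ r₀ > 0, ∃ y : ℕ → Y, (∀ j, y j ∈ S) ∧ (∀ j, ρ x (y j) ≤ 1) ∧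
      Tendsto (fun j => ρ x (y j)) atTop (𝓝 0) ∧
      ((p = 0 ∧ ∀ j, y j = x) ∨ (0 < p ∧ ∀ j, 0 < ρ x (y j))) ∧
      (∀ z ∈ S, ρ x z < r₀ → ∀ j, ψ₁ x + ψ₂ x + (p - a - 2 * ε) * ρ x (y j) -
        (p + a + 2 * ε) * ρ (y j) z ≤ ψ₁ z + ψ₂ z) ∧
      ∀ z ∈ S, ρ x z < r₀ → ψ₁ x + ψ₂ x - (p + a + 2 * ε) * ρ x z ≤ ψ₁ z + ψ₂ z := by
  obtain ⟨R₁, hR₁, hl₁⟩ := h₁.1.exists_lipschitz_of_eventually_slopeWrt_lt h hg hx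
    ((h₁.2.1 x hx).eventually_lt_const (show slopeWrt S ρ ψ₁ x < p + ε by linarith))
  obtain ⟨R₂, hR₂, hl₂⟩ := h₂.exists_lipschitz_of_eventually_slopeWrt_lt h hg hx
    (h₂.eventually_slopeWrt_lt h hx (show uscWrt S (slopeWrt S ρ ψ₂) x < a + ε by linarith))
  have hx0 := h.refl x hx
  have hr₀ : 0 < min R₁ R₂ := lt_min hR₁ hR₂
  have key : ∀ v ∈ S, ∀ z ∈ S, ρ x v < min R₁ R₂ → ρ x z < min R₁ R₂ →
      ψ₁ v + ψ₂ v - (p + a + 2 * ε) * ρ v z ≤ ψ₁ z + ψ₂ z := fun v hv z hz hvR hzR => by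
    have a1 := hl₁ z hz v hv (hzR.trans_le (min_le_left _ _)) (hvR.trans_le (min_le_left _ _))
    have a2 := hl₂ z hz v hv (hzR.trans_le (min_le_right _ _)) (hvR.trans_le (min_le_right _ _))
    rw [h.symm z hz v hv] at a1 a2
    linarith
  have keyx : ∀ z ∈ S, ρ x z < min R₁ R₂ →
      ψ₁ x + ψ₂ x - (p + a + 2 * ε) * ρ x z ≤ ψ₁ z + ψ₂ z := fun z hz hzR =>
    key x hx z hz (by rwa [hx0]) hzR
  rcases (hp ▸ slopeWrt_nonneg h hx ψ₁ : 0 ≤ p).eq_or_lt with hp0 | hp0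
  · refine ⟨min R₁ R₂, hr₀, fun _ => x, fun _ => hx, fun _ => by simp [hx0], by simp [hx0],
      Or.inl ⟨hp0.symm, fun _ => rfl⟩, fun z hz hzR _ => ?_, keyx⟩
    rw [hx0, mul_zero, add_zero]
    exact keyx z hz hzR
  have hup : upperSlopeWrt S ρ ψ₁ x = p := (h₁.2.2 x hx).trans hp
  have hex : ∀ j : ℕ, ∃ y ∈ S, (p - ε) * ρ x y ≤ ψ₁ y - ψ₁ x ∧ x ≠ y ∧
      ρ x y < min (min R₁ R₂) (1 / ((j : ℝ) + 1)) := fun j => by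
    obtain ⟨y, hy1, hy2⟩ := ((frequently_lt_of_lt_upperSlopeWrt (u := ψ₁) h hx (K := p - ε)
      (by linarith) (by linarith)).and_eventually (h.eventually_lt hx
      (lt_min hr₀ (by positivity : (0 : ℝ) < 1 / ((j : ℝ) + 1))))).exists
    exact ⟨y, hy2.1, hy1.1, hy1.2, hy2.2⟩
  choose y hyS hyψ hyx hyr using hex
  refine ⟨min R₁ R₂, hr₀, y, hyS, fun j => ?_, ?_, Or.inr ⟨hp0, fun j => h.pos hx (hyS j) (hyx j)⟩,
    fun z hz hzR j => ?_, keyx⟩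
  · refine ((hyr j).trans_le (min_le_right _ _)).le.trans ?_
    rw [div_le_one (by positivity)]
    linarith [Nat.cast_nonneg (α := ℝ) j]
  · exact squeeze_zero (fun j => h.nonneg hx (hyS j))
      (fun j => ((hyr j).trans_le (min_le_right _ _)).le) tendsto_one_div_add_atTop_nhds_zero_nat
  · have hyR := (hyr j).trans_le (min_le_left _ _)
    have a1 := key (y j) (hyS j) z hz hyR hzR
    have a2 := hl₂ (y j) (hyS j) x hx (hyR.trans_le (min_le_right _ _))
      (by rw [hx0]; exact hR₂)
    rw [h.symm _ (hyS j) x hx] at a2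
    linarith [hyψ j]

end TestFunction

/-- Sliding a smoothed cone with vertex `y` below a supersolution which is almost minimal at `z₀`
produces a nearby point where the supersolution inequality holds with controlled data. -/
theorem IsMVSupersolutionWrt.exists_nonneg_Hupp_of_cone_le [CompleteSpace Y] {S : Set Y}
    {ρ : Y → Y → ℝ} (hS : IsClosed S) (h : IsMetricOn S ρ) (hg : IsGeodesicWrt S ρ)
    {H : Y → ℝ → ℝ → ℝ} {u : Y → ℝ} (hsup : IsMVSupersolutionWrt S ρ H u) {C : ℝ}
    (hu : ∀ x ∈ S, |u x| ≤ C) {x₀ y z₀ : Y} (hx₀ : x₀ ∈ S) (hy : y ∈ S) (hz₀ : z₀ ∈ S)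
    {w p a ε τ r R D K : ℝ} (hp : 0 ≤ p) (ha : 0 ≤ a) (hε : 0 < ε) (hτ : 0 < τ) (hr : 0 ≤ r)
    (hD : D = (2 + 2 * p + (a + 3 * ε) + (2 * a + 5 * ε)) / ε)
    (hK : K = 3 + D + (p + a + 2 * ε) * (1 + D) + 3 * p + (a + 3 * ε))
    (hKR : K * (r + τ) < R) (hz₀R : ρ x₀ z₀ ≤ R) (hz₀w : lscWrt S u z₀ ≤ w + τ)
    (hyz₀ : |ρ y z₀ - r| ≤ τ) (hx₀y : ρ x₀ y ≤ 2 * r)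
    (hlow : ∀ z ∈ S, ρ x₀ z ≤ R →
      w - τ + (p - a - 2 * ε) * r - (p + a + 2 * ε) * ρ y z ≤ lscWrt S u z)
    (hpτ : p = 0 ∨ (2 * a + 5 * ε) * (p * τ) ≤ ε * (ε * r - (2 + 2 * p + (a + 3 * ε)) * τ)) :
    ∃ z ∈ S, ρ x₀ z ≤ K * (r + τ) ∧ |lscWrt S u z - w| ≤ K * (r + τ) ∧ ∃ a' p', 0 ≤ a' ∧
      0 ≤ p' ∧ |p' - p| + a' ≤ a + 5 * ε ∧ 0 ≤ Hupp H a' z (lscWrt S u z) p' := by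
  set G : Y → ℝ := fun z => lscWrt S u z + p * √(ρ y z ^ 2 + τ ^ 2) +
    (a + 3 * ε) * |ρ y z - r| with hG
  have hA : 0 ≤ a + 3 * ε := by positivity
  have hD0 : 0 ≤ D := by rw [hD]; positivity
  have hDε : ε * D = 2 + 2 * p + (a + 3 * ε) + (2 * a + 5 * ε) := by
    rw [hD]; field_simp
  have hrτ : 0 ≤ r + τ := by positivity
  have hsq : ∀ s, 0 ≤ s → √(s ^ 2 + τ ^ 2) ≤ s + τ := fun s hs => by
    rw [Real.sqrt_le_left (by positivity)]
    nlinarith [mul_nonneg hs hτ.le]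
  have hsq' : ∀ s : ℝ, s ≤ √(s ^ 2 + τ ^ 2) := fun s =>
    Real.le_sqrt_of_sq_le (by nlinarith [sq_nonneg τ])
  have hGz₀ : G z₀ ≤ w + τ + p * (r + 2 * τ) + (a + 3 * ε) * τ := by
    have h1 : √(ρ y z₀ ^ 2 + τ ^ 2) ≤ r + 2 * τ := by
      linarith [hsq _ (h.nonneg hy hz₀), (abs_le.1 hyz₀).2]
    have h2 := mul_le_mul_of_nonneg_left h1 hp
    have h3 := mul_le_mul_of_nonneg_left hyz₀ hA
    simp only [hG]
    linarith
  have hupper : ∀ z ∈ S, ρ x₀ z ≤ R → G z ≤ G z₀ → ρ y z ≤ D * (r + τ) := by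
    intro z hz hzR hGz
    have h1 := mul_le_mul_of_nonneg_left (hsq' (ρ y z)) hp
    have h2 := mul_le_mul_of_nonneg_left (le_abs_self (ρ y z - r)) hA
    have h3 := hlow z hz hzR
    have h4 := hGz.trans hGz₀
    simp only [hG] at h4
    have h5 : ε * ρ y z ≤ (2 + 2 * p + (a + 3 * ε)) * τ + (2 * a + 5 * ε) * r := by linarith
    have h6 : 0 ≤ (2 + 2 * p + (a + 3 * ε)) * r := by positivity
    have h7 : 0 ≤ (2 * a + 5 * ε) * τ := by positivity
    have h8 : ε * ρ y z ≤ ε * (D * (r + τ)) := by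
      rw [← mul_assoc, hDε]; linarith
    exact le_of_mul_le_mul_left h8 hε
  have hx₀z : ∀ z ∈ S, ρ x₀ z ≤ R → G z ≤ G z₀ → ρ x₀ z ≤ K * (r + τ) := by
    intro z hz hzR hGz
    have h1 := h.triangle x₀ hx₀ y hy z hz
    have h2 := hupper z hz hzR hGz
    have h3 : 0 ≤ (p + a + 2 * ε) * (1 + D) + 3 * p + (a + 3 * ε) := by positivity
    have h4 := mul_nonneg h3 hrτ
    rw [hK]
    linarith
  obtain ⟨z, hz, hzR, hGz, a', ha', haA, hH⟩ := hsup.exists_cone_touching hS h hg hu hx₀ hy hz₀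
    hp hA hε hτ hz₀R (G := G) (fun _ => rfl)
    fun z hz hzR hGz => (hx₀z z hz hzR hGz).trans_lt hKR
  have hs0 := h.nonneg hy hz
  have hsD := hupper z hz hzR.le hGz
  have hlz := hlow z hz hzR.le
  have hGw := hGz.trans hGz₀
  simp only [hG] at hGw
  have hsqrt : 0 < √(ρ y z ^ 2 + τ ^ 2) := Real.sqrt_pos.2 (by positivity)
  set s := ρ y z with hs
  have hp' : p * (s / √(s ^ 2 + τ ^ 2)) ≤ p :=
    mul_le_of_le_one_right hp ((div_le_one hsqrt).2 (hsq' s))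
  have hp'ε : p - ε ≤ p * (s / √(s ^ 2 + τ ^ 2)) := by
    rcases hpτ with rfl | hpτ
    · simpa using hε.le
    have h1 := mul_le_mul_of_nonneg_left (hsq' s) hp
    have h2 := mul_le_mul_of_nonneg_left (neg_abs_le (s - r)) hA
    have h3 : ε * r - (2 + 2 * p + (a + 3 * ε)) * τ ≤ (2 * a + 5 * ε) * s := by linarith
    have h4 : (2 * a + 5 * ε) * (p * τ) ≤ (2 * a + 5 * ε) * (ε * s) := by
      have := mul_le_mul_of_nonneg_left h3 hε.le
      linarith
    have h5 : p * τ ≤ ε * s := le_of_mul_le_mul_left h4 (by positivity)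
    rw [← mul_div_assoc, le_div_iff₀ hsqrt]
    have h6 := mul_le_mul_of_nonneg_left (hsq s hs0) hp
    have h7 := mul_le_mul_of_nonneg_left (hsq' s) hε.le
    linarith
  refine ⟨z, hz, hx₀z z hz hzR.le hGz, ?_, a', _, ha', by positivity, ?_, hH⟩
  · have h1 : 0 ≤ p * √(s ^ 2 + τ ^ 2) := by positivity
    have h2 : 0 ≤ (a + 3 * ε) * |s - r| := by positivity
    have h3 : 0 ≤ (p + a + 2 * ε) * (1 + D) + 3 * p + D + (a + 3 * ε) := by positivity
    have h4 : (p + a + 2 * ε) * s ≤ (p + a + 2 * ε) * (D * (r + τ)) :=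
      mul_le_mul_of_nonneg_left hsD (by positivity)
    have h5 : 0 ≤ p * r := by positivity
    have h6 : 0 ≤ p * τ := by positivity
    have h7 : 0 ≤ (a + 3 * ε) * r := by positivity
    have h8 : 0 ≤ (a + 3 * ε) * τ := by positivity
    have h9 : 0 ≤ D * (r + τ) := by positivity
    have h10 : 0 ≤ (p + a + 2 * ε) * (D * (r + τ)) := by positivity
    have h11 : 0 ≤ (p + a + 2 * ε) * τ := by positivity
    have h12 : 0 ≤ (p + a + 2 * ε) * r := by positivity
    rw [hK, abs_le]
    constructor <;> linarith
  · rw [abs_sub_comm, abs_of_nonneg (by linarith)]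
    linarith

end Sequences

/-- stability of metric viscosity supersolutions, noncompact case. -/
theorem stmt19 {Y : Type*} [MetricSpace Y] [CompleteSpace Y]
    (X : ℕ → Set Y) (Xi : Set Y)
    (d : ℕ → Y → Y → ℝ) (di : Y → Y → ℝ)
    (H : ℕ → Y → ℝ → ℝ → ℝ) (Hi : Y → ℝ → ℝ → ℝ)
    (u : ℕ → Y → ℝ)
    (hXne : ∀ n, (X n).Nonempty) (hXcl : ∀ n, IsClosed (X n))
    (hXine : Xi.Nonempty) (hXicl : IsClosed Xi)
    (hmet : ∀ n, IsMetricOn (X n) (d n)) (hgeo : ∀ n, IsGeodesicWrt (X n) (d n))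
    (hmeti : IsMetricOn Xi di) (hgeoi : IsGeodesicWrt Xi di)
    (hHc : ∀ n, ContinuousOn (fun q : Y × ℝ × ℝ => H n q.1 q.2.1 q.2.2)
      (X n ×ˢ (univ : Set ℝ) ×ˢ Ici (0:ℝ)))
    (hHic : ContinuousOn (fun q : Y × ℝ × ℝ => Hi q.1 q.2.1 q.2.2)
      (Xi ×ˢ (univ : Set ℝ) ×ˢ Ici (0:ℝ)))
    (h1fin : ∀ n, EMetric.hausdorffEdist (X n) Xi ≠ ⊤)
    (h1 : Tendsto (fun n => hausdorffDist (X n) Xi) atTop (𝓝 0))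
    (h2 : ∀ a ∈ Xi, ∀ b ∈ Xi, ∀ an bn : ℕ → Y, (∀ n, an n ∈ X n) → (∀ n, bn n ∈ X n) →
      Tendsto an atTop (𝓝 a) → Tendsto bn atTop (𝓝 b) →
      Tendsto (fun n => d n (an n) (bn n)) atTop (𝓝 (di a b)))
    (h3 : ∀ x ∈ Xi, ∀ xn : ℕ → Y, (∀ n, xn n ∈ X n) → Tendsto xn atTop (𝓝 x) →
      ∀ r p : ℝ, 0 ≤ p → ∀ rn pn : ℕ → ℝ, (∀ n, 0 ≤ pn n) →
      Tendsto rn atTop (𝓝 r) → Tendsto pn atTop (𝓝 p) →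
      Tendsto (fun n => H n (xn n) (rn n) (pn n)) atTop (𝓝 (Hi x r p)))
    (h4m : ∀ a ∈ Xi, ∀ an : ℕ → Y, (∀ n, an n ∈ X n) → Tendsto an atTop (𝓝 a) →
      ∀ φn : ℕ → Y → ℝ, ∀ φi : Y → ℝ,
      (∃ C : ℝ, ∀ n, ∀ x ∈ X n, |φn n x| ≤ C) → (∃ C : ℝ, ∀ x ∈ Xi, |φi x| ≤ C) →
      (∀ n, LowerSemicontinuousOn (φn n) (X n)) → LowerSemicontinuousOn φi Xi →
      (∀ x ∈ Xi, ∀ xn : ℕ → Y, (∀ n, xn n ∈ X n) → Tendsto xn atTop (𝓝 x) →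
        φi x ≤ Filter.liminf (fun n => φn n (xn n)) atTop) →
      ∃ δ : ℝ, 0 < δ ∧ ∀ r : ℝ, 0 < r → r < δ →
        sInf (φi '' {x | x ∈ Xi ∧ di a x ≤ r}) ≤
          Filter.liminf (fun n => sInf (φn n '' {x | x ∈ X n ∧ d n (an n) x ≤ r})) atTop)
    (hsup : ∀ n, IsMVSupersolutionWrt (X n) (d n) (H n) (u n))
    (hbdd : ∃ C : ℝ, ∀ n, ∀ x ∈ X n, |u n x| ≤ C) :
    IsMVSupersolutionWrt Xi di Hi (fun x => sInf {L : ℝ | ∃ xn : ℕ → Y,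
      (∀ n, xn n ∈ X n) ∧ Tendsto xn atTop (𝓝 x) ∧
      Filter.liminf (fun n => u n (xn n)) atTop = L}) := by
  obtain ⟨C, hu⟩ := hbdd
  change IsMVSupersolutionWrt Xi di Hi (lowerSemilimit X u)
  intro ψ₁ ψ₂ h₁ h₂ x hx hmin
  by_contra! hneg
  set w := lscWrt Xi (lowerSemilimit X u) x with hw
  set p := slopeWrt Xi di ψ₁ x with hp
  set a := uscWrt Xi (slopeWrt Xi di ψ₂) x with ha
  have hp0 : 0 ≤ p := slopeWrt_nonneg hmeti hx ψ₁
  have ha0 : 0 ≤ a := uscWrt_slopeWrt_nonneg hmeti ψ₂ x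
  have hfill : ∀ z ∈ Xi, ∃ zs : ℕ → Y, (∀ n, zs n ∈ X n) ∧ Tendsto zs atTop (𝓝 z) :=
    fun z hz => exists_seq_tendsto_of_hausdorffDist h1fin hXne h1 hz
  have huI : ∀ z ∈ Xi, |lowerSemilimit X u z| ≤ C := fun z hz => by
    obtain ⟨zs, hzs, hzt⟩ := hfill z hz
    exact abs_lowerSemilimit_le hu hzs hzt
  obtain ⟨xs, hxs, hxt⟩ := hfill x hx
  obtain ⟨θ, hθ, hHupp⟩ := eventually_Hupp_neg hHic h3 hx hxs hxt hneg
  set ε := θ / 6 with hε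
  have hε0 : 0 < ε := by positivity
  obtain ⟨r₁, hr₁, y, hyX, hy1, hyt, hpy, hcone, hcone0⟩ :=
    exists_cones_le_test hmeti hgeoi h₁ h₂ hx hp.symm ha.symm hε0
  obtain ⟨r₂, hr₂, hmin⟩ := hmeti.exists_of_eventually hx hmin
  have hmin' : ∀ z ∈ Xi, di x z < min r₁ r₂ →
      w - (ψ₁ x + ψ₂ x) ≤ lowerSemilimit X u z - (ψ₁ z + ψ₂ z) := fun z hz hzr => by
    have := hmin z hz (hzr.trans_le (min_le_right _ _))
    linarith [lscWrt_le huI hz]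
  have hys : ∀ j, ∃ ys : ℕ → Y, (∀ n, ys n ∈ X n) ∧ Tendsto ys atTop (𝓝 (y j)) ∧
      ∀ n, d n (xs n) (ys n) ≤ 2 * di x (y j) := fun j => by
    rcases hpy with ⟨-, hyx⟩ | ⟨-, hpos⟩
    · rw [hyx j, hmeti.refl x hx]
      exact ⟨xs, hxs, hxt, fun n => by rw [(hmet n).refl _ (hxs n)]; simp⟩
    · classical
      obtain ⟨ys, hysX, hyst⟩ := hfill (y j) (hyX j)
      refine ⟨fun n => if d n (xs n) (ys n) ≤ 2 * di x (y j) then ys n else xs n,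
        fun n => ?_, ?_, fun n => ?_⟩
      · beta_reduce
        split_ifs
        exacts [hysX n, hxs n]
      · refine hyst.congr' ?_
        filter_upwards [(h2 x hx (y j) (hyX j) xs ys hxs hysX hxt hyst).eventually_le_const
          (show di x (y j) < 2 * di x (y j) by linarith [hpos j])] with n hn
        rw [if_pos hn]
      · beta_reduce
        split_ifs with hle
        · exact hle
        · rw [(hmet n).refl _ (hxs n)]
          linarith [hpos j]
  choose ys hysX hyst hxys using hys
  obtain ⟨R, hR, hlow⟩ := exists_eventually_cone_le_lscWrt (w := w) (L := p + a + 2 * ε)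
    (k := p - a - 2 * ε) hmet hmeti h2 h4m hu hx hxs hxt (by positivity) (lt_min hr₁ hr₂) hyX hysX
    hyst (fun j => hmeti.nonneg hx (hyX j)) hy1 hyt hxys
    (fun z hz hzr j => by
      linarith [hmin' z hz hzr, hcone z hz (hzr.trans_le (min_le_left _ _)) j])
    (fun z hz hzr => by
      linarith [hmin' z hz hzr, hcone0 z hz (hzr.trans_le (min_le_left _ _))])
  obtain ⟨D, hD⟩ : ∃ D, D = (2 + 2 * p + (a + 3 * ε) + (2 * a + 5 * ε)) / ε := ⟨_, rfl⟩
  obtain ⟨K, hK⟩ : ∃ K, K = 3 + D + (p + a + 2 * ε) * (1 + D) + 3 * p + (a + 3 * ε) := ⟨_, rfl⟩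
  obtain ⟨j, hj⟩ : ∃ j, K * di x (y j) < min R (θ / 2) := by
    have := hyt.const_mul K
    rw [mul_zero] at this
    exact (this.eventually_lt_const (lt_min hR (half_pos hθ))).exists
  set r := di x (y j) with hr
  have hr0 : 0 ≤ r := hmeti.nonneg hx (hyX j)
  have hpos : ∀ᶠ τ in 𝓝[>] (0 : ℝ), 0 < τ := self_mem_nhdsWithin
  have hsmall : ∀ᶠ τ in 𝓝[>] (0 : ℝ), K * (r + τ) < min R (θ / 2) := by
    refine eventually_nhdsWithin_of_eventually_nhds
      (Tendsto.eventually_lt_const (u := min R (θ / 2)) (v := K * (r + 0)) (by simpa using hj)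
        (Continuous.tendsto (f := fun τ => K * (r + τ)) (by fun_prop) 0))
  have hsteep : ∀ᶠ τ in 𝓝[>] (0 : ℝ), p = 0 ∨
      (2 * a + 5 * ε) * (p * τ) ≤ ε * (ε * r - (2 + 2 * p + (a + 3 * ε)) * τ) := by
    rcases hpy with ⟨hp, -⟩ | ⟨-, hpos⟩
    · exact Eventually.of_forall fun _ => Or.inl hp
    · refine eventually_nhdsWithin_of_eventually_nhds (Eventually.mono ?_ fun _ => Or.inr ∘ le_of_lt)
      refine ContinuousAt.eventually_lt (f := fun τ => (2 * a + 5 * ε) * (p * τ))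
        (g := fun τ => ε * (ε * r - (2 + 2 * p + (a + 3 * ε)) * τ)) (by fun_prop) (by fun_prop) ?_
      have := hpos j
      simp only [mul_zero, sub_zero]
      positivity
  obtain ⟨τ, hτ, hsmall, hsteep⟩ := (hpos.and (hsmall.and hsteep)).exists
  obtain ⟨θ₁, hθ₁, hdx⟩ := eventually_abs_metric_sub_lt h2 hx hx hxs hxs hxt hxt hR
  obtain ⟨θ₂, hθ₂, hdy⟩ :=
    eventually_abs_metric_sub_lt h2 hx (hyX j) hxs (hysX j) hxt (hyst j) hτ
  obtain ⟨v, hvw, hvX, hvx⟩ := ((frequently_lt_of_lscWrt_lt huI hx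
    (lt_add_of_pos_right w hτ)).and_eventually
      ((eventually_mem_nhdsWithin (a := x) (s := Xi)).and (eventually_nhdsWithin_of_eventually_nhds
        (ball_mem_nhds x (lt_min hθ₁ hθ₂))))).exists
  obtain ⟨vs, hvsX, hvst⟩ := hfill v hvX
  obtain ⟨zs, hzsX, hzst, hzsw⟩ := exists_frequently_lt hu hvsX hvst hvw
  obtain ⟨n, hzw, hzx, hxn, hHn, hlown, hdxn, hdyn⟩ := (hzsw.and_eventually
    ((hzst.eventually (isOpen_ball.mem_nhds hvx)).and
      ((hxt.eventually (ball_mem_nhds x (half_pos hθ))).and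
        (hHupp.and ((hlow τ hτ).and (hdx.and hdy)))))).exists
  have hdxz := hdxn _ (hzsX n) (hzx.trans_le (min_le_left _ _))
  have hdyz := hdyn _ (hzsX n) (hzx.trans_le (min_le_right _ _))
  rw [hmeti.refl x hx, sub_zero] at hdxz
  rw [hmeti.symm _ (hyX j) x hx] at hdyz
  obtain ⟨z, hz, hxz, hzw', a', p', ha', hp', hap, hH⟩ :=
    (hsup n).exists_nonneg_Hupp_of_cone_le (hXcl n) (hmet n) (hgeo n) (hu n) (hxs n) (hysX j n)
      (hzsX n) hp0 ha0 hε0 hτ hr0 hD hK (hsmall.trans_le (min_le_left _ _))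
      ((le_abs_self _).trans hdxz.le) ((lscWrt_le (hu n) (hzsX n)).trans hzw.le) hdyz.le
      (hxys j n) (fun z hz hzR => hlown z hz hzR j) hsteep
  have hKθ := hsmall.trans_le (min_le_right _ _)
  refine (hHn z hz ?_ _ ?_ a' p' ha' hp' ?_).not_ge hH
  · have e1 := dist_triangle z (xs n) x
    have e2 := (hmet n).ge_dist _ (hxs n) z hz
    have e3 : dist (xs n) x < θ / 2 := hxn
    rw [dist_comm] at e2
    linarith
  · linarith
  · linarith
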